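/- arXiv:1711.05056 — 4 statements merged into one kernel-verified Lean document; each statement's English description precedes it below -/
import Mathlib

section
/- Let β=1, s=s₁=1, and let u be three times continuously differentiable on [a,b]. Then there exist constants C₁,C₂>0, possibly depending on a, b, λ, g and the values of u, u′, u″, u‴ on [a,b], but independent of M and h, such that for every integer M≥3 with h=(b−a)/(M+1)<1, the linear system H U_h = F has a unique solution U_h and ‖U−U_h‖ ≤ C₁ |ln h| h² and ‖U−U_h‖_∞ ≤ C₂ |ln h| h². -/
open MeasureTheory Set

noncomputable section

/-- Grid spacing `h = (b−a)/(M+1)`. -/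
def gH (a b : ℝ) (M : ℕ) : ℝ := (b - a) / (M + 1)

/-- Grid points `x_i = a + i h`, `i = 0,…,M+1`. -/
def gX (a b : ℝ) (M i : ℕ) : ℝ := a + i * gH a b M

/-- `A₁(i,s,k) = h^{−s−1} ∫_{x_{k−1}}^{x_k} (x_k−y)(x_i−y)^{s−1−β} dy`. -/
def cA1 (a b β : ℝ) (s M i k : ℕ) : ℝ :=
  gH a b M ^ (-(s : ℝ) - 1) *
    ∫ y in gX a b M (k - 1)..gX a b M k,
      (gX a b M k - y) * (gX a b M i - y) ^ ((s : ℝ) - 1 - β)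

/-- `A₂(i,s,k) = h^{−s−1} ∫_{x_{k−1}}^{x_k} (y−x_{k−1})(x_i−y)^{s−1−β} dy`. -/
def cA2 (a b β : ℝ) (s M i k : ℕ) : ℝ :=
  gH a b M ^ (-(s : ℝ) - 1) *
    ∫ y in gX a b M (k - 1)..gX a b M k,
      (y - gX a b M (k - 1)) * (gX a b M i - y) ^ ((s : ℝ) - 1 - β)

/-- `A₃(i,s,k) = h^{−s−1} ∫_{x_{k−1}}^{x_k} (x_k−y)(y−x_i)^{s−1−β} dy`. -/
def cA3 (a b β : ℝ) (s M i k : ℕ) : ℝ :=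
  gH a b M ^ (-(s : ℝ) - 1) *
    ∫ y in gX a b M (k - 1)..gX a b M k,
      (gX a b M k - y) * (y - gX a b M i) ^ ((s : ℝ) - 1 - β)

/-- `A₄(i,s,k) = h^{−s−1} ∫_{x_{k−1}}^{x_k} (y−x_{k−1})(y−x_i)^{s−1−β} dy`. -/
def cA4 (a b β : ℝ) (s M i k : ℕ) : ℝ :=
  gH a b M ^ (-(s : ℝ) - 1) *
    ∫ y in gX a b M (k - 1)..gX a b M k,
      (y - gX a b M (k - 1)) * (y - gX a b M i) ^ ((s : ℝ) - 1 - β)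

/-- `B₁(i) = ∫_{−∞}^a e^{λ(y−x_i)} (x_i−y)^{−1−β} dy`. -/
def cB1 (a b β lam : ℝ) (M i : ℕ) : ℝ :=
  ∫ y in Iio a, Real.exp (lam * (y - gX a b M i)) * (gX a b M i - y) ^ (-1 - β)

/-- `B₂(i) = ∫_b^∞ e^{λ(x_i−y)} (y−x_i)^{−1−β} dy`. -/
def cB2 (a b β lam : ℝ) (M i : ℕ) : ℝ :=
  ∫ y in Ioi b, Real.exp (lam * (gX a b M i - y)) * (y - gX a b M i) ^ (-1 - β)

/-- Off-diagonal entries `h_{i,j}` (in 1-based indexing, `1 ≤ i,j ≤ M`, `i ≠ j`) of the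
stiffness matrix. -/
def offD (a b β lam : ℝ) (s s₁ M i j : ℕ) : ℝ :=
  if j + 2 ≤ i then
    -((cA1 a b β s M i (j + 1) + cA2 a b β s M i j) *
        Real.exp (-lam * ((i : ℝ) - j) * gH a b M) * ((i : ℝ) - j) ^ (-(s : ℝ)))
  else if j + 1 = i then
    -(gH a b M ^ (-β) * Real.exp (-lam * gH a b M) / ((s₁ : ℝ) + 1 - β))
      - cA2 a b β s M i (i - 1) * Real.exp (-lam * gH a b M)
  else if j = i + 1 then
    -(gH a b M ^ (-β) * Real.exp (-lam * gH a b M) / ((s₁ : ℝ) + 1 - β))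
      - cA3 a b β s M i (i + 2) * Real.exp (-lam * gH a b M)
  else if i + 2 ≤ j then
    -((cA3 a b β s M i (j + 1) + cA4 a b β s M i j) *
        Real.exp (-lam * ((j : ℝ) - i) * gH a b M) * ((j : ℝ) - i) ^ (-(s : ℝ)))
  else 0

/-- The prescribed value of `h_{i,i} + Σ_{j≠i} h_{i,j} − B₁(i) − B₂(i)` (1-based index `i`). -/
def diagExtra (a b β lam : ℝ) (s s₁ M i : ℕ) : ℝ :=
  if i = 1 then
    gH a b M ^ (-β) * Real.exp (-lam * gH a b M) / ((s₁ : ℝ) + 1 - β)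
      + cA4 a b β s M 1 (M + 1) * Real.exp (-lam * M * gH a b M) * (M : ℝ) ^ (-(s : ℝ))
  else if i = M then
    gH a b M ^ (-β) * Real.exp (-lam * gH a b M) / ((s₁ : ℝ) + 1 - β)
      + cA1 a b β s M M 1 * Real.exp (-lam * M * gH a b M) * (M : ℝ) ^ (-(s : ℝ))
  else
    cA1 a b β s M i 1 * Real.exp (-lam * i * gH a b M) * (i : ℝ) ^ (-(s : ℝ))
      + cA4 a b β s M i (M + 1) * Real.exp (-lam * ((M : ℝ) + 1 - i) * gH a b M) *
          ((M : ℝ) + 1 - i) ^ (-(s : ℝ))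

/-- The `M×M` stiffness matrix `H = (h_{i,j})`: off-diagonal entries given by `offD`, and
diagonal entries defined so that
`h_{i,i} + Σ_{j≠i} h_{i,j} − B₁(i) − B₂(i) = diagExtra i`. -/
def stiff (a b β lam : ℝ) (s s₁ M : ℕ) : Matrix (Fin M) (Fin M) ℝ :=
  fun i j =>
    if i = j then
      cB1 a b β lam M (i.val + 1) + cB2 a b β lam M (i.val + 1)
        + diagExtra a b β lam s s₁ M (i.val + 1)
        - ∑ k ∈ Finset.univ.erase i, offD a b β lam s s₁ M (i.val + 1) (k.val + 1)
    else offD a b β lam s s₁ M (i.val + 1) (j.val + 1)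

/-- `d₁(i) = ∫_{−∞}^a g(y) e^{−λ(x_i−y)} (x_i−y)^{−1−β} dy`. -/
def dd1 (a b β lam : ℝ) (g : ℝ → ℝ) (M i : ℕ) : ℝ :=
  ∫ y in Iio a, g y * Real.exp (-lam * (gX a b M i - y)) * (gX a b M i - y) ^ (-1 - β)

/-- `d₂(i) = ∫_b^∞ g(y) e^{−λ(y−x_i)} (y−x_i)^{−1−β} dy`. -/
def dd2 (a b β lam : ℝ) (g : ℝ → ℝ) (M i : ℕ) : ℝ :=
  ∫ y in Ioi b, g y * Real.exp (-lam * (y - gX a b M i)) * (y - gX a b M i) ^ (-1 - β)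

/-- The load vector `F`. -/
def loadF (a b β lam : ℝ) (s s₁ : ℕ) (f g u : ℝ → ℝ) (M : ℕ) : Fin M → ℝ :=
  fun i =>
    f (gX a b M (i.val + 1)) + dd1 a b β lam g M (i.val + 1) + dd2 a b β lam g M (i.val + 1)
      + (if i.val + 1 = 1 then
            gH a b M ^ (-β) * Real.exp (-lam * gH a b M) / ((s₁ : ℝ) + 1 - β)
          else
            cA1 a b β s M (i.val + 1) 1 * Real.exp (-lam * ((i.val : ℝ) + 1) * gH a b M) *
              ((i.val : ℝ) + 1) ^ (-(s : ℝ))) * u a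
      + (if i.val + 1 = M then
            gH a b M ^ (-β) * Real.exp (-lam * gH a b M) / ((s₁ : ℝ) + 1 - β)
          else
            cA4 a b β s M (i.val + 1) (M + 1) *
              Real.exp (-lam * ((M : ℝ) - i.val) * gH a b M) *
              ((M : ℝ) - (i.val : ℝ)) ^ (-(s : ℝ))) * u b

/-- The discrete `L²` norm `‖v‖ = (h Σᵢ vᵢ²)^{1/2}`. -/
def dnorm2 (a b : ℝ) (M : ℕ) (v : Fin M → ℝ) : ℝ :=
  Real.sqrt (gH a b M * ∑ i, v i ^ 2)

end

noncomputable section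

open MeasureTheory Set Filter

theorem abs_sub_le_of_hasDerivAt {F F' : ℝ → ℝ} {p q C : ℝ}
    (hF : ∀ y ∈ Icc p q, HasDerivAt F (F' y) y) (hC : ∀ y ∈ Icc p q, |F' y| ≤ C)
    {y z : ℝ} (hy : y ∈ Icc p q) (hz : z ∈ Icc p q) : |F z - F y| ≤ C * |z - y| :=
  (convex_Icc p q).norm_image_sub_le_of_norm_hasDerivWithin_le
    (fun t ht => (hF t ht).hasDerivWithinAt) hC hy hz

/-- Error of linear interpolation at the endpoints of an interval. -/
theorem linear_interp_error {φ φ' φ'' : ℝ → ℝ} {p q K : ℝ} (hpq : p < q)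
    (h1 : ∀ y ∈ Icc p q, HasDerivAt φ (φ' y) y)
    (h2 : ∀ y ∈ Icc p q, HasDerivAt φ' (φ'' y) y)
    (hK : ∀ y ∈ Icc p q, |φ'' y| ≤ K) {y : ℝ} (hy : y ∈ Icc p q) :
    |φ y - (φ p * ((q - y) / (q - p)) + φ q * ((y - p) / (q - p)))| ≤ K * (q - p) ^ 2 := by
  have hq : 0 < q - p := sub_pos.2 hpq
  have hp : p ∈ Icc p q := left_mem_Icc.2 hpq.le
  have hK0 : 0 ≤ K := (abs_nonneg _).trans (hK p hp)
  obtain ⟨ξ, hξ, hξe⟩ := exists_hasDerivAt_eq_slope φ φ' hpq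
    (fun t ht => (h1 t ht).continuousAt.continuousWithinAt)
    (fun t ht => h1 t (Ioo_subset_Icc_self ht))
  set E : ℝ → ℝ := fun y => φ y - (φ p * ((q - y) / (q - p)) + φ q * ((y - p) / (q - p))) with hE
  have hEd : ∀ t ∈ Icc p q, HasDerivAt E (φ' t - φ' ξ) t := by
    intro t ht
    have hb : HasDerivAt (fun y : ℝ => φ p * ((q - y) / (q - p)) + φ q * ((y - p) / (q - p)))
        (φ p * ((-1) / (q - p)) + φ q * (1 / (q - p))) t :=
      ((((hasDerivAt_id t).const_sub q).div_const _).const_mul _).add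
        ((((hasDerivAt_id t).sub_const p).div_const _).const_mul _)
    have := (h1 t ht).sub hb
    refine this.congr_deriv ?_
    rw [hξe]; field_simp; ring
  have hEb : ∀ t ∈ Icc p q, |φ' t - φ' ξ| ≤ K * (q - p) := by
    intro t ht
    refine (abs_sub_le_of_hasDerivAt h2 hK (Ioo_subset_Icc_self hξ) ht).trans ?_
    gcongr
    rw [abs_le]; constructor <;> linarith [ht.1, ht.2, hξ.1, hξ.2]
  have h0 : E p = 0 := by simp only [hE]; field_simp; ring
  have := abs_sub_le_of_hasDerivAt hEd hEb hp hy
  rw [h0, sub_zero] at this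
  refine this.trans ?_
  rw [sq, ← mul_assoc]
  gcongr
  rw [abs_le]; constructor <;> linarith [hy.1, hy.2]

/-- Value, first and second derivative of `z ↦ (W 0 - W z) / z * exp (-lam z)`, with a bound
on the second derivative in terms of bounds on the derivatives of `W`. -/
theorem weighted_divided_difference_bound {W W1 W2 W3 : ℝ → ℝ} {lam L K1 K2 K3 : ℝ}
    (hlam : 0 ≤ lam)
    (hW : ∀ z, HasDerivAt W (W1 z) z) (hW1 : ∀ z, HasDerivAt W1 (W2 z) z)
    (hW2 : ∀ z, HasDerivAt W2 (W3 z) z)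
    (hK1 : ∀ z ∈ Icc 0 L, |W1 z| ≤ K1) (hK2 : ∀ z ∈ Icc 0 L, |W2 z| ≤ K2)
    (hK3 : ∀ z ∈ Icc 0 L, |W3 z| ≤ K3) :
    ∃ φ' φ'' : ℝ → ℝ, ∀ z ∈ Ioc 0 L,
      HasDerivAt (fun z => (W 0 - W z) / z * Real.exp (-lam * z)) (φ' z) z ∧
      HasDerivAt φ' (φ'' z) z ∧ |φ'' z| ≤ K3 + 2 * lam * K2 + lam ^ 2 * K1 := by
  set D : ℝ → ℝ := fun z => (W 0 - W z) / z with hD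
  set D1 : ℝ → ℝ := fun z => -(z * W1 z - (W z - W 0)) / z ^ 2 with hD1
  set D2 : ℝ → ℝ := fun z => -(z ^ 2 * W2 z - 2 * z * W1 z + 2 * (W z - W 0)) / z ^ 3 with hD2
  have dE : ∀ z, HasDerivAt (fun z => Real.exp (-lam * z)) (-lam * Real.exp (-lam * z)) z := by
    intro z
    have := ((hasDerivAt_id z).const_mul (-lam)).exp
    simpa [mul_comm] using this
  have dD : ∀ z, 0 < z → HasDerivAt D (D1 z) z := by
    intro z hz
    refine (((hW z).const_sub (W 0)).div (hasDerivAt_id z) hz.ne').congr_deriv ?_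
    simp only [hD1, id]; field_simp; ring
  have dD1 : ∀ z, 0 < z → HasDerivAt D1 (D2 z) z := by
    intro z hz
    refine (((((hasDerivAt_id z).mul (hW1 z)).sub ((hW z).sub_const (W 0))).neg).div
      (hasDerivAt_pow 2 z) (by positivity)).congr_deriv ?_
    simp [hD2]; field_simp; ring
  refine ⟨fun z => (D1 z - lam * D z) * Real.exp (-lam * z),
    fun z => (D2 z - 2 * lam * D1 z + lam ^ 2 * D z) * Real.exp (-lam * z), ?_⟩
  rintro z ⟨hz, hzL⟩
  refine ⟨?_, ?_, ?_⟩
  · refine ((dD z hz).mul (dE z)).congr_deriv ?_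
    ring
  · refine (((dD1 z hz).sub ((dD z hz).const_mul lam)).mul (dE z)).congr_deriv ?_
    simp only [Pi.sub_apply]
    ring
  · have h0z : (0 : ℝ) ∈ Icc 0 z := ⟨le_rfl, hz.le⟩
    have hzz : z ∈ Icc 0 z := ⟨hz.le, le_rfl⟩
    have sub : ∀ t ∈ Icc 0 z, t ∈ Icc 0 L := fun t ht => ⟨ht.1, ht.2.trans hzL⟩
    have b0 : |D z| ≤ K1 := by
      have := abs_sub_le_of_hasDerivAt (F := W) (p := 0) (q := z) (fun t _ => hW t)
        (fun t ht => hK1 t (sub t ht)) hzz h0z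
      rw [zero_sub, abs_neg] at this
      simp only [hD]
      rw [abs_div, div_le_iff₀ (abs_pos.2 hz.ne')]
      exact this
    have b1 : |D1 z| ≤ K2 := by
      have := abs_sub_le_of_hasDerivAt (F := fun z => z * W1 z - (W z - W 0))
        (F' := fun z => z * W2 z) (C := z * K2) (p := 0) (q := z)
        (fun t _ => (((hasDerivAt_id t).mul (hW1 t)).sub ((hW t).sub_const (W 0))).congr_deriv
          (by simp))
        (fun t ht => by
          rw [abs_mul, abs_of_nonneg ht.1]
          exact mul_le_mul ht.2 (hK2 t (sub t ht)) (abs_nonneg _) hz.le) h0z hzz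
      simp only [zero_mul, sub_self, sub_zero, abs_of_pos hz] at this
      simp only [hD1]
      rw [abs_div, abs_neg, abs_of_pos (pow_pos hz 2), div_le_iff₀ (pow_pos hz 2)]
      linarith
    have b2 : |D2 z| ≤ K3 := by
      have := abs_sub_le_of_hasDerivAt
        (F := fun z => z ^ 2 * W2 z - 2 * z * W1 z + 2 * (W z - W 0))
        (F' := fun z => z ^ 2 * W3 z) (C := z ^ 2 * K3) (p := 0) (q := z)
        (fun t _ => (((hasDerivAt_pow 2 t).mul (hW2 t)).sub
          (((hasDerivAt_id t).const_mul 2).mul (hW1 t)) |>.add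
            (((hW t).sub_const (W 0)).const_mul 2)).congr_deriv
          (by simp; ring))
        (fun t ht => by
          rw [abs_mul, abs_of_nonneg (pow_nonneg ht.1 2)]
          exact mul_le_mul (pow_le_pow_left₀ ht.1 ht.2 2) (hK3 t (sub t ht)) (abs_nonneg _)
            (by positivity)) h0z hzz
      simp only [abs_of_pos hz, sub_zero] at this
      norm_num at this
      simp only [hD2]
      rw [abs_div, abs_neg, abs_of_pos (pow_pos hz 3), div_le_iff₀ (pow_pos hz 3)]
      linarith
    have hexp : Real.exp (-lam * z) ≤ 1 := by
      rw [Real.exp_le_one_iff]; nlinarith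
    rw [abs_mul, abs_of_pos (Real.exp_pos _)]
    have hs : |D2 z - 2 * lam * D1 z + lam ^ 2 * D z| ≤ K3 + 2 * lam * K2 + lam ^ 2 * K1 := by
      calc _ ≤ |D2 z| + |2 * lam * D1 z| + |lam ^ 2 * D z| :=
            (abs_add_le _ _).trans (add_le_add (abs_sub _ _) le_rfl)
        _ = |D2 z| + 2 * lam * |D1 z| + lam ^ 2 * |D z| := by
            rw [abs_mul, abs_mul (lam ^ 2), abs_of_nonneg (by positivity : 0 ≤ 2 * lam),
              abs_of_nonneg (by positivity : 0 ≤ lam ^ 2)]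
        _ ≤ _ := by gcongr
    calc _ ≤ |D2 z - 2 * lam * D1 z + lam ^ 2 * D z| * 1 := by gcongr
      _ ≤ _ := by rw [mul_one]; exact hs

/-- The kernel `e^{-lam z} / z²` of the tempered fractional Laplacian of order one. -/
def kern (lam z : ℝ) : ℝ := Real.exp (-lam * z) / z ^ 2

/-- Weight of the left endpoint of `[m h, (m+1) h]` in the product trapezoidal rule for
the weight `1 / z`. -/
def wα (h : ℝ) (m : ℕ) : ℝ :=
  h⁻¹ * ∫ z in (m * h)..((m + 1 : ℕ) * h), ((m + 1 : ℕ) * h - z) * z⁻¹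

/-- Weight of the right endpoint of `[m h, (m+1) h]` in the product trapezoidal rule for
the weight `1 / z`. -/
def wβ (h : ℝ) (m : ℕ) : ℝ :=
  h⁻¹ * ∫ z in (m * h)..((m + 1 : ℕ) * h), (z - m * h) * z⁻¹

/-- Error of the product trapezoidal rule on one interval. -/
theorem product_trapezoid_cell_error {φ φ' φ'' : ℝ → ℝ} {p q K : ℝ} (hp : 0 < p) (hpq : p < q)
    (h1 : ∀ y ∈ Icc p q, HasDerivAt φ (φ' y) y)
    (h2 : ∀ y ∈ Icc p q, HasDerivAt φ' (φ'' y) y)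
    (hK : ∀ y ∈ Icc p q, |φ'' y| ≤ K) :
    |(∫ z in p..q, φ z * z⁻¹) -
      ((q - p)⁻¹ * (∫ z in p..q, (q - z) * z⁻¹) * φ p +
        (q - p)⁻¹ * (∫ z in p..q, (z - p) * z⁻¹) * φ q)| ≤
      K * (q - p) ^ 2 * ∫ z in p..q, z⁻¹ := by
  have hI : uIcc p q = Icc p q := uIcc_of_le hpq.le
  have hne : ∀ z ∈ uIcc p q, z ≠ 0 := fun z hz => by
    rw [hI] at hz; exact (hp.trans_le hz.1).ne'
  have cinv : ContinuousOn (fun z : ℝ => z⁻¹) (uIcc p q) := continuousOn_id.inv₀ hne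
  have cφ : ContinuousOn φ (uIcc p q) := by
    rw [hI]; exact fun t ht => (h1 t ht).continuousAt.continuousWithinAt
  have i1 : IntervalIntegrable (fun z => φ z * z⁻¹) volume p q :=
    (cφ.mul cinv).intervalIntegrable
  have i2 : IntervalIntegrable (fun z => (q - z) * z⁻¹) volume p q :=
    ((continuousOn_const.sub continuousOn_id).mul cinv).intervalIntegrable
  have i3 : IntervalIntegrable (fun z => (z - p) * z⁻¹) volume p q :=
    ((continuousOn_id.sub continuousOn_const).mul cinv).intervalIntegrable
  have e : (∫ z in p..q, φ z * z⁻¹) -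
      ((q - p)⁻¹ * (∫ z in p..q, (q - z) * z⁻¹) * φ p +
        (q - p)⁻¹ * (∫ z in p..q, (z - p) * z⁻¹) * φ q) =
      ∫ z in p..q, (φ z - (φ p * ((q - z) / (q - p)) + φ q * ((z - p) / (q - p)))) * z⁻¹ := by
    have e1 : (q - p)⁻¹ * (∫ z in p..q, (q - z) * z⁻¹) * φ p =
        ∫ z in p..q, ((q - p)⁻¹ * φ p) * ((q - z) * z⁻¹) := by
      rw [intervalIntegral.integral_const_mul]; ring
    have e2 : (q - p)⁻¹ * (∫ z in p..q, (z - p) * z⁻¹) * φ q =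
        ∫ z in p..q, ((q - p)⁻¹ * φ q) * ((z - p) * z⁻¹) := by
      rw [intervalIntegral.integral_const_mul]; ring
    rw [e1, e2, ← intervalIntegral.integral_add (i2.const_mul _) (i3.const_mul _),
      ← intervalIntegral.integral_sub i1 ((i2.const_mul _).add (i3.const_mul _))]
    congr 1; ext z; ring
  rw [e, ← intervalIntegral.integral_const_mul, ← Real.norm_eq_abs]
  refine intervalIntegral.norm_integral_le_of_norm_le hpq.le ?_
    (cinv.intervalIntegrable.const_mul _)
  filter_upwards with z hz
  rw [Real.norm_eq_abs, abs_mul, abs_of_pos (inv_pos.2 (hp.trans hz.1))]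
  exact mul_le_mul_of_nonneg_right
    (linear_interp_error hpq h1 h2 hK (Ioc_subset_Icc_self hz))
    (inv_pos.2 (hp.trans hz.1)).le

/-- Error of the composite product trapezoidal rule on `[h, N h]`. -/
theorem product_trapezoid_error {W W1 W2 W3 : ℝ → ℝ} {lam h K1 K2 K3 : ℝ} {N : ℕ}
    (hlam : 0 ≤ lam) (hh : 0 < h) (hN : 1 ≤ N)
    (hW : ∀ z, HasDerivAt W (W1 z) z) (hW1 : ∀ z, HasDerivAt W1 (W2 z) z)
    (hW2 : ∀ z, HasDerivAt W2 (W3 z) z)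
    (hK1 : ∀ z ∈ Icc 0 (N * h), |W1 z| ≤ K1) (hK2 : ∀ z ∈ Icc 0 (N * h), |W2 z| ≤ K2)
    (hK3 : ∀ z ∈ Icc 0 (N * h), |W3 z| ≤ K3) :
    |(∫ z in h..(N * h), (W 0 - W z) * kern lam z) -
      ∑ m ∈ Finset.Ico 1 N,
        (wα h m * ((W 0 - W (m * h)) / (m * h) * Real.exp (-lam * (m * h))) +
         wβ h m * ((W 0 - W ((m + 1 : ℕ) * h)) / ((m + 1 : ℕ) * h) *
          Real.exp (-lam * ((m + 1 : ℕ) * h))))| ≤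
      (K3 + 2 * lam * K2 + lam ^ 2 * K1) * h ^ 2 * Real.log N := by
  obtain ⟨φ', φ'', H⟩ :=
    weighted_divided_difference_bound (L := N * h) hlam hW hW1 hW2 hK1 hK2 hK3
  set φ : ℝ → ℝ := fun z => (W 0 - W z) / z * Real.exp (-lam * z) with hφ
  set K := K3 + 2 * lam * K2 + lam ^ 2 * K1 with hK
  have hcell : ∀ m ∈ Ico 1 N, 0 < (m : ℝ) * h ∧ (m : ℝ) * h < ((m + 1 : ℕ) : ℝ) * h ∧
      Icc ((m : ℝ) * h) (((m + 1 : ℕ) : ℝ) * h) ⊆ Ioc 0 (N * h) := by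
    intro m hm
    have hm0 : 0 < (m : ℝ) * h := mul_pos (by exact_mod_cast hm.1) hh
    refine ⟨hm0, by push_cast; nlinarith, fun t ht => ⟨hm0.trans_le ht.1, ht.2.trans ?_⟩⟩
    have : ((m + 1 : ℕ) : ℝ) ≤ N := by exact_mod_cast hm.2
    gcongr
  have hpos : ∀ m ∈ Ico 1 N, ∀ t ∈ uIcc ((m : ℝ) * h) (((m + 1 : ℕ) : ℝ) * h), t ∈ Ioc 0 (N * h) := by
    intro m hm t ht
    rw [uIcc_of_le (hcell m hm).2.1.le] at ht
    exact (hcell m hm).2.2 ht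
  have iinv : ∀ m ∈ Ico 1 N, IntervalIntegrable (fun z : ℝ => z⁻¹) volume ((m : ℝ) * h)
      (((m + 1 : ℕ) : ℝ) * h) := fun m hm =>
    (continuousOn_id.inv₀ fun t ht => (hpos m hm t ht).1.ne').intervalIntegrable
  have iφ : ∀ m ∈ Ico 1 N, IntervalIntegrable (fun z : ℝ => φ z * z⁻¹) volume ((m : ℝ) * h)
      (((m + 1 : ℕ) : ℝ) * h) := fun m hm =>
    (ContinuousOn.mul (fun t ht => (H t (hpos m hm t ht)).1.continuousAt.continuousWithinAt)
      (continuousOn_id.inv₀ fun t ht => (hpos m hm t ht).1.ne')).intervalIntegrable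
  have e1 : (∫ z in h..(N * h), (W 0 - W z) * kern lam z) =
      ∑ m ∈ Finset.Ico 1 N, ∫ z in ((m : ℝ) * h)..(((m + 1 : ℕ) : ℝ) * h), φ z * z⁻¹ := by
    rw [intervalIntegral.sum_integral_adjacent_intervals_Ico (a := fun m : ℕ => (m : ℝ) * h) hN iφ]
    simp only [Nat.cast_one, one_mul]
    congr 1; ext z
    simp only [hφ, kern]
    rcases eq_or_ne z 0 with rfl | hz
    · simp
    · field_simp
  have e2 : Real.log N = ∑ m ∈ Finset.Ico 1 N, ∫ z in ((m : ℝ) * h)..(((m + 1 : ℕ) : ℝ) * h), z⁻¹ := by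
    rw [intervalIntegral.sum_integral_adjacent_intervals_Ico (a := fun m : ℕ => (m : ℝ) * h) hN iinv,
      integral_inv_of_pos (by simpa using hh) (mul_pos (by exact_mod_cast hN) hh)]
    congr 1; field_simp; simp
  rw [e1, e2, ← Finset.sum_sub_distrib, Finset.mul_sum]
  refine (Finset.abs_sum_le_sum_abs _ _).trans (Finset.sum_le_sum fun m hm => ?_)
  have hm' : m ∈ Ico 1 N := by simpa using hm
  obtain ⟨hp, hpq, hs⟩ := hcell m hm'
  have := product_trapezoid_cell_error (φ := φ) hp hpq (fun t ht => (H t (hs ht)).1)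
    (fun t ht => (H t (hs ht)).2.1) (fun t ht => (H t (hs ht)).2.2)
  have hd : ((m + 1 : ℕ) : ℝ) * h - m * h = h := by push_cast; ring
  rw [hd] at this
  exact this

/-- Error of the one-point rule for the singular part of the principal value integral. -/
theorem singular_part_error {U U1 U2 U3 : ℝ → ℝ} {x lam h ε K2 K3 : ℝ}
    (hlam : 0 ≤ lam) (hε : 0 < ε) (hεh : ε < h)
    (hU : ∀ z, HasDerivAt U (U1 z) z) (hU1 : ∀ z, HasDerivAt U1 (U2 z) z)
    (hU2 : ∀ z, HasDerivAt U2 (U3 z) z)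
    (hK2 : |U2 x| ≤ K2) (hK3 : ∀ z ∈ Icc (x - h) (x + h), |U3 z| ≤ K3) :
    |(∫ z in ε..h, (2 * U x - U (x + z) - U (x - z)) * kern lam z) -
      h * ((2 * U x - U (x + h) - U (x - h)) * kern lam h)| ≤
      (K2 * lam + 4 * K3) * h ^ 2 +
        ε * |(2 * U x - U (x + h) - U (x - h)) * kern lam h| := by
  have hh : 0 < h := hε.trans hεh
  have hK30 : 0 ≤ K3 := (abs_nonneg _).trans (hK3 x ⟨by linarith, by linarith⟩)
  have hK20 : 0 ≤ K2 := (abs_nonneg _).trans hK2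
  set S : ℝ → ℝ := fun z => 2 * U x - U (x + z) - U (x - z) with hS
  set t : ℝ → ℝ := fun z => S z + U2 x * z ^ 2 with ht
  have dp : ∀ {F F' : ℝ → ℝ} (_ : ∀ z, HasDerivAt F (F' z) z) (z : ℝ),
      HasDerivAt (fun z => F (x + z)) (F' (x + z)) z := fun hF z => by
    exact (hF (x + z)).comp_const_add x z
  have dm : ∀ {F F' : ℝ → ℝ} (_ : ∀ z, HasDerivAt F (F' z) z) (z : ℝ),
      HasDerivAt (fun z => F (x - z)) (-F' (x - z)) z := fun hF z => by
    exact (hF (x - z)).comp_const_sub x z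
  have dt : ∀ z, HasDerivAt t (-U1 (x + z) + U1 (x - z) + 2 * U2 x * z) z := fun z => by
    refine ((((dp hU z).const_sub (2 * U x)).sub (dm hU z)).add
      ((hasDerivAt_pow 2 z).const_mul (U2 x))).congr_deriv ?_
    norm_num; ring
  have dt1 : ∀ z, HasDerivAt (fun z => -U1 (x + z) + U1 (x - z) + 2 * U2 x * z)
      (-U2 (x + z) - U2 (x - z) + 2 * U2 x) z := fun z => by
    refine (((dp hU1 z).neg.add (dm hU1 z)).add
      ((hasDerivAt_id z).const_mul (2 * U2 x))).congr_deriv ?_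
    ring
  have b2 : ∀ z ∈ Icc 0 h, |-U2 (x + z) - U2 (x - z) + 2 * U2 x| ≤ 2 * K3 * z := by
    intro z hz
    have hx : x ∈ Icc (x - h) (x + h) := ⟨by linarith, by linarith⟩
    have h1 := abs_sub_le_of_hasDerivAt (fun y _ => hU2 y) hK3
      (z := x) (y := x + z) ⟨by linarith [hz.1], by linarith [hz.2]⟩ hx
    have h2 := abs_sub_le_of_hasDerivAt (fun y _ => hU2 y) hK3
      (z := x) (y := x - z) ⟨by linarith [hz.2], by linarith [hz.1]⟩ hx
    rw [show x - (x + z) = -z by ring, abs_neg, abs_of_nonneg hz.1] at h1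
    rw [show x - (x - z) = z by ring, abs_of_nonneg hz.1] at h2
    rw [abs_le] at *
    constructor <;> linarith [h1.1, h1.2, h2.1, h2.2]
  have b1 : ∀ z ∈ Icc 0 h, |-U1 (x + z) + U1 (x - z) + 2 * U2 x * z| ≤ 2 * K3 * z * z := by
    intro z hz
    have := abs_sub_le_of_hasDerivAt (p := 0) (q := z) (C := 2 * K3 * z) (fun y _ => dt1 y)
      (fun y hy => (b2 y ⟨hy.1, hy.2.trans hz.2⟩).trans (by gcongr; exact hy.2))
      (y := 0) (z := z) ⟨le_rfl, hz.1⟩ ⟨hz.1, le_rfl⟩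
    simpa [abs_of_nonneg hz.1] using this
  have b0 : ∀ z ∈ Icc 0 h, |t z| ≤ 2 * K3 * z * z ^ 2 := by
    intro z hz
    have := abs_sub_le_of_hasDerivAt (p := 0) (q := z) (C := 2 * K3 * z * z) (fun y _ => dt y)
      (fun y hy => (b1 y ⟨hy.1, hy.2.trans hz.2⟩).trans
        (by have := hy.1; have := hz.1; have := hy.2; gcongr))
      (y := 0) (z := z) ⟨le_rfl, hz.1⟩ ⟨hz.1, le_rfl⟩
    have h0 : t 0 = 0 := by simp [ht, hS]; ring
    rw [h0, sub_zero, sub_zero, abs_of_nonneg hz.1] at this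
    linarith
  have hψ : ∀ z, 0 < z → S z * kern lam z =
      -U2 x * Real.exp (-lam * z) + t z / z ^ 2 * Real.exp (-lam * z) := fun z hz => by
    simp only [kern, ht]; field_simp; ring
  have btail : ∀ z ∈ Ioc 0 h, |t z / z ^ 2 * Real.exp (-lam * z)| ≤ 2 * K3 * h := by
    rintro z ⟨hz, hzh⟩
    have he : Real.exp (-lam * z) ≤ 1 := by rw [Real.exp_le_one_iff]; nlinarith
    rw [abs_mul, abs_div, abs_of_pos (Real.exp_pos _), abs_of_pos (pow_pos hz 2)]
    have h1 : |t z| / z ^ 2 ≤ 2 * K3 * z :=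
      (div_le_iff₀ (pow_pos hz 2)).2 (b0 z ⟨hz.le, hzh⟩)
    calc _ ≤ 2 * K3 * z * 1 := mul_le_mul h1 he (Real.exp_pos _).le (by positivity)
      _ ≤ _ := by rw [mul_one]; gcongr
  have bexp : ∀ z ∈ Ioc 0 h, |Real.exp (-lam * z) - Real.exp (-lam * h)| ≤ lam * h := by
    rintro z ⟨hz, hzh⟩
    have h1 : Real.exp (-lam * h) ≤ Real.exp (-lam * z) := by
      rw [Real.exp_le_exp]; nlinarith
    have h2 : Real.exp (-lam * z) ≤ 1 := by rw [Real.exp_le_one_iff]; nlinarith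
    have h3 := Real.add_one_le_exp (-lam * h)
    rw [abs_of_nonneg (by linarith)]
    linarith
  have bψ : ∀ z ∈ Ioc 0 h, |S z * kern lam z - S h * kern lam h| ≤ (K2 * lam + 4 * K3) * h := by
    intro z hz
    have hhm : h ∈ Ioc 0 h := ⟨hh, le_rfl⟩
    rw [hψ z hz.1, hψ h hh]
    have e : -U2 x * Real.exp (-lam * z) + t z / z ^ 2 * Real.exp (-lam * z) -
        (-U2 x * Real.exp (-lam * h) + t h / h ^ 2 * Real.exp (-lam * h)) =
        -U2 x * (Real.exp (-lam * z) - Real.exp (-lam * h)) +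
          t z / z ^ 2 * Real.exp (-lam * z) - t h / h ^ 2 * Real.exp (-lam * h) := by ring
    rw [e]
    have h1 : |-U2 x * (Real.exp (-lam * z) - Real.exp (-lam * h))| ≤ K2 * (lam * h) := by
      rw [abs_mul, abs_neg]
      exact mul_le_mul hK2 (bexp z hz) (abs_nonneg _) hK20
    have := (abs_sub (-U2 x * (Real.exp (-lam * z) - Real.exp (-lam * h)) +
          t z / z ^ 2 * Real.exp (-lam * z)) (t h / h ^ 2 * Real.exp (-lam * h))).trans
      (add_le_add (abs_add_le _ _) le_rfl)
    linarith [btail z hz, btail h hhm]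
  have cS : Continuous S := by
    have : Continuous U := continuous_iff_continuousAt.2 fun z => (hU z).continuousAt
    fun_prop
  have iS : IntervalIntegrable (fun z => S z * kern lam z) volume ε h := by
    refine (cS.continuousOn.mul ?_).intervalIntegrable
    unfold kern
    refine ContinuousOn.div (by fun_prop) (by fun_prop) fun z hz => ?_
    rw [uIcc_of_le hεh.le] at hz
    exact (pow_pos (hε.trans_le hz.1) 2).ne'
  have e : (∫ z in ε..h, S z * kern lam z) - h * (S h * kern lam h) =
      (∫ z in ε..h, (S z * kern lam z - S h * kern lam h)) - ε * (S h * kern lam h) := by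
    rw [intervalIntegral.integral_sub iS intervalIntegrable_const, intervalIntegral.integral_const,
      smul_eq_mul]
    ring
  have hb := intervalIntegral.norm_integral_le_of_norm_le_const (a := ε) (b := h)
    (f := fun z => S z * kern lam z - S h * kern lam h) (C := (K2 * lam + 4 * K3) * h)
    (fun z hz => by
      rw [uIoc_of_le hεh.le] at hz
      exact bψ z ⟨hε.trans hz.1, hz.2⟩)
  rw [Real.norm_eq_abs, abs_of_pos (sub_pos.2 hεh)] at hb
  change |(∫ z in ε..h, S z * kern lam z) - h * (S h * kern lam h)| ≤ _
  rw [e]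
  refine (abs_sub _ _).trans (add_le_add (hb.trans ?_) ?_)
  · rw [sq, ← mul_assoc]; gcongr; linarith
  · rw [abs_mul, abs_of_pos hε]

/-- A function on `[a, b]` whose derivative extends continuously extends to a function that is
differentiable everywhere. -/
theorem exists_hasDerivAt_extension {v V' : ℝ → ℝ} {a b : ℝ}
    (hV' : Continuous V') (hv : ContinuousOn v (Icc a b))
    (hd : ∀ y ∈ Ioo a b, HasDerivAt v (V' y) y) :
    ∃ V : ℝ → ℝ, (∀ y, HasDerivAt V (V' y) y) ∧ ∀ y ∈ Icc a b, V y = v y := by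
  have hV : ∀ y, HasDerivAt (fun y => v a + ∫ t in a..y, V' t) (V' y) y := fun y =>
    (intervalIntegral.integral_hasDerivAt_right (hV'.intervalIntegrable _ _)
      (hV'.stronglyMeasurableAtFilter _ _) hV'.continuousAt).const_add (v a)
  refine ⟨_, hV, fun y hy => ?_⟩
  have := intervalIntegral.integral_eq_sub_of_hasDerivAt_of_le hy.1
    (hv.mono (Icc_subset_Icc le_rfl hy.2))
    (fun t ht => hd t ⟨ht.1, ht.2.trans_le hy.2⟩) (hV'.intervalIntegrable _ _)
  simp only [this]; ring

/-- A `C³` function on `[a, b]` extends to a function which is three times differentiable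
everywhere, with continuous third derivative. -/
theorem exists_C3_extension {u : ℝ → ℝ} {a b : ℝ} (hab : a < b)
    (hu : ContDiffOn ℝ 3 u (Icc a b)) :
    ∃ U U1 U2 U3 : ℝ → ℝ, (∀ y ∈ Icc a b, U y = u y) ∧ (∀ z, HasDerivAt U (U1 z) z) ∧
      (∀ z, HasDerivAt U1 (U2 z) z) ∧ (∀ z, HasDerivAt U2 (U3 z) z) ∧ Continuous U3 := by
  have hs : UniqueDiffOn ℝ (Icc a b) := uniqueDiffOn_Icc hab
  have step : ∀ k : ℕ, k < 3 → ∀ y ∈ Ioo a b,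
      HasDerivAt (iteratedDerivWithin k u (Icc a b)) (iteratedDerivWithin (k + 1) u (Icc a b) y) y := by
    intro k hk y hy
    have hyc := Ioo_subset_Icc_self hy
    have hd := (hu.differentiableOn_iteratedDerivWithin (m := k) (by exact_mod_cast hk) hs) y hyc
    rw [iteratedDerivWithin_succ]
    exact hd.hasDerivWithinAt.hasDerivAt (Icc_mem_nhds hy.1 hy.2)
  have cont : ∀ k : ℕ, k ≤ 3 → ContinuousOn (iteratedDerivWithin k u (Icc a b)) (Icc a b) :=
    fun k hk => hu.continuousOn_iteratedDerivWithin (by exact_mod_cast hk) hs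
  set U3 : ℝ → ℝ := IccExtend hab.le ((Icc a b).domRestrict (iteratedDerivWithin 3 u (Icc a b)))
    with hU3
  have c3 : Continuous U3 := (continuousOn_iff_continuous_domRestrict.1 (cont 3 le_rfl)).Icc_extend'
  have ext : ∀ (k : ℕ) (V' : ℝ → ℝ), k < 3 → Continuous V' →
      (∀ y ∈ Icc a b, V' y = iteratedDerivWithin (k + 1) u (Icc a b) y) →
      ∃ V : ℝ → ℝ, (∀ y, HasDerivAt V (V' y) y) ∧
        ∀ y ∈ Icc a b, V y = iteratedDerivWithin k u (Icc a b) y := fun k V' hk hc he =>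
    exists_hasDerivAt_extension hc (cont k hk.le) fun y hy => by
      rw [he y (Ioo_subset_Icc_self hy)]; exact step k hk y hy
  have cd : ∀ {F F' : ℝ → ℝ}, (∀ z, HasDerivAt F (F' z) z) → Continuous F := fun h =>
    continuous_iff_continuousAt.2 fun z => (h z).continuousAt
  obtain ⟨U2, d2, e2⟩ := ext 2 U3 (by norm_num) c3 fun y hy => by
    rw [hU3, IccExtend_of_mem hab.le _ hy]; rfl
  obtain ⟨U1, d1, e1⟩ := ext 1 U2 (by norm_num) (cd d2) e2
  obtain ⟨U, d0, e0⟩ := ext 0 U1 (by norm_num) (cd d1) e1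
  exact ⟨U, U1, U2, U3, fun y hy => by simpa using e0 y hy, d0, d1, d2, c3⟩

theorem kern_nonneg (lam z : ℝ) : 0 ≤ kern lam z := by
  unfold kern; positivity

theorem integrableOn_kern {lam p : ℝ} (hlam : 0 ≤ lam) (hp : 0 < p) :
    IntegrableOn (kern lam) (Ioi p) := by
  have h0 : IntegrableOn (fun z : ℝ => z ^ (-2 : ℝ)) (Ioi p) :=
    integrableOn_Ioi_rpow_of_lt (by norm_num) hp
  refine Integrable.mono' h0 ?_ ?_
  · unfold kern; exact (by fun_prop : Measurable _).aestronglyMeasurable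
  · filter_upwards [ae_restrict_mem measurableSet_Ioi] with z hz
    have hz0 : 0 < z := hp.trans hz
    rw [Real.norm_eq_abs, abs_of_nonneg (kern_nonneg _ _), kern, Real.rpow_neg hz0.le,
      ← one_div, Real.rpow_ofNat]
    gcongr
    rw [Real.exp_le_one_iff]; nlinarith

/-- A lower bound for the tail mass of the kernel, uniform for `z` in a bounded range. -/
theorem le_integral_kern {lam p L : ℝ} (hlam : 0 ≤ lam) (hp : 0 < p) (hpL : p ≤ L) :
    kern lam (L + 1) ≤ ∫ z in Ioi p, kern lam z := by
  have hi := integrableOn_kern hlam hp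
  have hsub : Ioc p (p + 1) ⊆ Ioi p := Ioc_subset_Ioi_self
  calc kern lam (L + 1) = ∫ _ in Ioc p (p + 1), kern lam (L + 1) := by simp
    _ ≤ ∫ z in Ioc p (p + 1), kern lam z := by
        refine setIntegral_mono_on (by simp) (hi.mono_set hsub) measurableSet_Ioc fun z hz => ?_
        have hz0 : 0 < z := hp.trans hz.1
        have hzL : z ≤ L + 1 := hz.2.trans (by linarith)
        unfold kern
        apply div_le_div₀ (Real.exp_pos _).le _ (by positivity) (by gcongr)
        rw [Real.exp_le_exp]; nlinarith
    _ ≤ _ := setIntegral_mono_set hi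
        (Filter.Eventually.of_forall fun z => kern_nonneg _ _) hsub.eventuallyLE

/-- Splitting of the one-sided truncated integral. -/
theorem one_sided_split {w W : ℝ → ℝ} {lam ε h L : ℝ} (hlam : 0 ≤ lam) (hε : 0 < ε)
    (hεh : ε ≤ h) (hhL : h ≤ L) (hW : Continuous W) (hw : ∀ z ∈ Icc 0 L, w z = W z)
    (hint : IntegrableOn (fun z => w z * kern lam z) (Ioi L)) :
    IntegrableOn (fun z => (w 0 - w z) * kern lam z) (Ioi ε) ∧
    ∫ z in Ioi ε, (w 0 - w z) * kern lam z =
      w 0 * (∫ z in Ioi L, kern lam z) - (∫ z in Ioi L, w z * kern lam z) +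
      (∫ z in ε..h, (W 0 - W z) * kern lam z) + ∫ z in h..L, (W 0 - W z) * kern lam z := by
  have hh : 0 < h := hε.trans_le hεh
  have hL : 0 < L := hh.trans_le hhL
  have hεL := hεh.trans hhL
  have hk := (integrableOn_kern hlam hL).const_mul (w 0)
  have hc : ∀ p q, 0 < p → p ≤ q →
      IntervalIntegrable (fun z => (W 0 - W z) * kern lam z) volume p q := by
    intro p q hp hpq
    refine ContinuousOn.intervalIntegrable ((by fun_prop : ContinuousOn _ _).mul ?_)
    unfold kern
    refine ContinuousOn.div (by fun_prop) (by fun_prop) fun z hz => ?_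
    rw [uIcc_of_le hpq] at hz
    exact (pow_pos (hp.trans_le hz.1) 2).ne'
  have heq : EqOn (fun z => (W 0 - W z) * kern lam z) (fun z => (w 0 - w z) * kern lam z)
      (Ioc ε L) := fun z hz => by
    simp only
    rw [hw 0 ⟨le_rfl, hL.le⟩, hw z ⟨hε.le.trans hz.1.le, hz.2⟩]
  have i1 : IntegrableOn (fun z => (w 0 - w z) * kern lam z) (Ioc ε L) :=
    ((intervalIntegrable_iff_integrableOn_Ioc_of_le hεL).1 (hc ε L hε hεL)).congr_fun heq
      measurableSet_Ioc
  have i2 : IntegrableOn (fun z => (w 0 - w z) * kern lam z) (Ioi L) := by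
    refine (hk.sub hint).congr (Filter.Eventually.of_forall fun z => ?_)
    simp only [Pi.sub_apply]; ring
  rw [← Ioc_union_Ioi_eq_Ioi hεL]
  refine ⟨i1.union i2, ?_⟩
  rw [setIntegral_union (Ioc_disjoint_Ioi le_rfl) measurableSet_Ioi i1 i2]
  have e1 : ∫ z in Ioc ε L, (w 0 - w z) * kern lam z =
      (∫ z in ε..h, (W 0 - W z) * kern lam z) + ∫ z in h..L, (W 0 - W z) * kern lam z := by
    rw [intervalIntegral.integral_add_adjacent_intervals (hc ε h hε hεh) (hc h L hh hhL),
      intervalIntegral.integral_of_le hεL]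
    exact (setIntegral_congr_fun measurableSet_Ioc heq).symm
  have e2 : ∫ z in Ioi L, (w 0 - w z) * kern lam z =
      w 0 * (∫ z in Ioi L, kern lam z) - (∫ z in Ioi L, w z * kern lam z) := by
    simp only [sub_mul]
    rw [integral_sub hk hint, integral_const_mul]
  rw [e1, e2]; ring

theorem setIntegral_comp_const_sub (F : ℝ → ℝ) (x p : ℝ) :
    ∫ y in Iio (x - p), F y = ∫ z in Ioi p, F (x - z) := by
  have := (Measure.measurePreserving_sub_left volume x).setIntegral_preimage_emb
    (MeasurableEquiv.subLeft x).measurableEmbedding F (Iio (x - p))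
  rw [← this]
  congr 2; ext z; simp

theorem setIntegral_comp_const_add (F : ℝ → ℝ) (x p : ℝ) :
    ∫ y in Ioi (x + p), F y = ∫ z in Ioi p, F (x + z) := by
  have := (measurePreserving_add_left volume x).setIntegral_preimage_emb
    (MeasurableEquiv.addLeft x).measurableEmbedding F (Ioi (x + p))
  rw [← this]
  congr 2; ext z; simp

theorem integrableOn_comp_const_sub {F : ℝ → ℝ} {x p : ℝ} :
    IntegrableOn (fun z => F (x - z)) (Ioi p) ↔ IntegrableOn F (Iio (x - p)) := by
  have := (Measure.measurePreserving_sub_left volume x).integrableOn_comp_preimage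
    (MeasurableEquiv.subLeft x).measurableEmbedding (f := F) (s := Iio (x - p))
  rw [← this]
  have e : (fun z => x - z) ⁻¹' Iio (x - p) = Ioi p := by ext z; simp
  rw [e]; rfl

theorem integrableOn_comp_const_add {F : ℝ → ℝ} {x p : ℝ} :
    IntegrableOn (fun z => F (x + z)) (Ioi p) ↔ IntegrableOn F (Ioi (x + p)) := by
  have := (measurePreserving_add_left volume x).integrableOn_comp_preimage
    (MeasurableEquiv.addLeft x).measurableEmbedding (f := F) (s := Ioi (x + p))
  rw [← this]
  have e : (fun z => x + z) ⁻¹' Ioi (x + p) = Ioi p := by ext z; simp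
  rw [e]; rfl

/-- One-sided quadrature of `z ↦ (w 0 - w z) * kern lam z` on `[0, N h]`: one-point rule on
`[0, h]` and product trapezoidal rule on `[h, N h]`. -/
def quad (lam h : ℝ) (N : ℕ) (w : ℝ → ℝ) : ℝ :=
  h * ((w 0 - w h) * kern lam h) +
    ∑ m ∈ Finset.Ico 1 N,
        (wα h m * ((w 0 - w (m * h)) / (m * h) * Real.exp (-lam * (m * h))) +
         wβ h m * ((w 0 - w ((m + 1 : ℕ) * h)) / ((m + 1 : ℕ) * h) *
          Real.exp (-lam * ((m + 1 : ℕ) * h))))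

/-- Consistency of the quadrature with the principal value integral. -/
theorem principal_value_quad_error {u U U1 U2 U3 : ℝ → ℝ} {x lam h K1 K2 K3 fx : ℝ} {n₁ n₂ : ℕ}
    (hlam : 0 ≤ lam) (hh : 0 < h) (hn₁ : 1 ≤ n₁) (hn₂ : 1 ≤ n₂)
    (hU : ∀ z, HasDerivAt U (U1 z) z) (hU1 : ∀ z, HasDerivAt U1 (U2 z) z)
    (hU2 : ∀ z, HasDerivAt U2 (U3 z) z)
    (hK1 : ∀ z ∈ Icc (x - n₁ * h) (x + n₂ * h), |U1 z| ≤ K1)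
    (hK2 : ∀ z ∈ Icc (x - n₁ * h) (x + n₂ * h), |U2 z| ≤ K2)
    (hK3 : ∀ z ∈ Icc (x - n₁ * h) (x + n₂ * h), |U3 z| ≤ K3)
    (huU : ∀ z ∈ Icc (x - n₁ * h) (x + n₂ * h), u z = U z)
    (hi₁ : IntegrableOn (fun z => u (x - z) * kern lam z) (Ioi (n₁ * h)))
    (hi₂ : IntegrableOn (fun z => u (x + z) * kern lam z) (Ioi (n₂ * h)))
    (hf : Filter.Tendsto
      (fun ε : ℝ => ∫ y in {y : ℝ | ε < |x - y|},
          (u x - u y) * Real.exp (-lam * |x - y|) * |x - y| ^ (-1 - 1 : ℝ))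
        (nhdsWithin 0 (Ioi 0)) (nhds fx)) :
    |fx - (U x * ((∫ z in Ioi (n₁ * h), kern lam z) + ∫ z in Ioi (n₂ * h), kern lam z) -
      (∫ z in Ioi (n₁ * h), u (x - z) * kern lam z) -
      (∫ z in Ioi (n₂ * h), u (x + z) * kern lam z) +
      quad lam h n₁ (fun z => U (x - z)) + quad lam h n₂ (fun z => U (x + z)))| ≤
    (K2 * lam + 4 * K3) * h ^ 2 +
      (K3 + 2 * lam * K2 + lam ^ 2 * K1) * h ^ 2 * (Real.log n₁ + Real.log n₂) := by
  have hL₁ : h ≤ n₁ * h := le_mul_of_one_le_left hh.le (by exact_mod_cast hn₁)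
  have hL₂ : h ≤ n₂ * h := le_mul_of_one_le_left hh.le (by exact_mod_cast hn₂)
  have hx : x ∈ Icc (x - n₁ * h) (x + n₂ * h) := ⟨by linarith, by linarith⟩
  have cU : Continuous U := continuous_iff_continuousAt.2 fun z => (hU z).continuousAt
  have mem₁ : ∀ z ∈ Icc 0 (n₁ * h), x - z ∈ Icc (x - n₁ * h) (x + n₂ * h) := fun z hz =>
    ⟨by linarith [hz.2], by linarith [hz.1]⟩
  have mem₂ : ∀ z ∈ Icc 0 (n₂ * h), x + z ∈ Icc (x - n₁ * h) (x + n₂ * h) := fun z hz =>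
    ⟨by linarith [hz.1], by linarith [hz.2]⟩
  have q₁ := product_trapezoid_error (W := fun z => U (x - z)) (W1 := fun z => -U1 (x - z))
    (W2 := fun z => U2 (x - z)) (W3 := fun z => -U3 (x - z)) hlam hh hn₁
    (fun z => (hU _).comp_const_sub x z)
    (fun z => ((hU1 _).comp_const_sub x z).neg.congr_deriv (neg_neg _))
    (fun z => (hU2 _).comp_const_sub x z)
    (fun z hz => by rw [abs_neg]; exact hK1 _ (mem₁ z hz))
    (fun z hz => hK2 _ (mem₁ z hz))
    (fun z hz => by rw [abs_neg]; exact hK3 _ (mem₁ z hz))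
  have q₂ := product_trapezoid_error (W := fun z => U (x + z)) (W1 := fun z => U1 (x + z))
    (W2 := fun z => U2 (x + z)) (W3 := fun z => U3 (x + z)) hlam hh hn₂
    (fun z => (hU _).comp_const_add x z) (fun z => (hU1 _).comp_const_add x z)
    (fun z => (hU2 _).comp_const_add x z)
    (fun z hz => hK1 _ (mem₂ z hz)) (fun z hz => hK2 _ (mem₂ z hz))
    (fun z hz => hK3 _ (mem₂ z hz))
  set P₁ := ∫ z in Ioi (n₁ * h), kern lam z
  set P₂ := ∫ z in Ioi (n₂ * h), kern lam z
  set G₁ := ∫ z in Ioi (n₁ * h), u (x - z) * kern lam z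
  set G₂ := ∫ z in Ioi (n₂ * h), u (x + z) * kern lam z
  set T := U x * (P₁ + P₂) - G₁ - G₂ + quad lam h n₁ (fun z => U (x - z)) +
    quad lam h n₂ (fun z => U (x + z)) with hT
  set K := K3 + 2 * lam * K2 + lam ^ 2 * K1 with hK
  set E := |(2 * U x - U (x + h) - U (x - h)) * kern lam h| with hE
  set C := (K2 * lam + 4 * K3) * h ^ 2 + K * h ^ 2 * (Real.log n₁ + Real.log n₂) with hC
  have key : ∀ ε ∈ Ioo 0 h, |(∫ y in {y : ℝ | ε < |x - y|},
      (u x - u y) * Real.exp (-lam * |x - y|) * |x - y| ^ (-1 - 1 : ℝ)) - T| ≤ C + ε * E := by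
    rintro ε ⟨hε, hεh⟩
    set I : ℝ → ℝ := fun y => (u x - u y) * Real.exp (-lam * |x - y|) * |x - y| ^ (-1 - 1 : ℝ)
      with hI
    have hset : {y : ℝ | ε < |x - y|} = Iio (x - ε) ∪ Ioi (x + ε) := by
      ext y
      simp only [mem_ofPred_eq, lt_abs, mem_union, mem_Iio, mem_Ioi]
      constructor <;> rintro (h | h) <;> [left; right; left; right] <;> linarith
    have ek : ∀ y z, 0 < z → |x - y| = z → I y = (u x - u y) * kern lam z := by
      intro y z hz hyz
      simp only [hI, hyz, kern]
      rw [show (-1 - 1 : ℝ) = -2 by norm_num, Real.rpow_neg hz.le, Real.rpow_ofNat, mul_assoc,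
        div_eq_mul_inv]
    have s₁ := one_sided_split (w := fun z => u (x - z)) (W := fun z => U (x - z)) hlam hε
      hεh.le hL₁ (by fun_prop) (fun z hz => huU _ (mem₁ z hz)) hi₁
    have s₂ := one_sided_split (w := fun z => u (x + z)) (W := fun z => U (x + z)) hlam hε
      hεh.le hL₂ (by fun_prop) (fun z hz => huU _ (mem₂ z hz)) hi₂
    simp only [sub_zero, add_zero] at s₁ s₂ q₁ q₂
    have f₁ : EqOn (fun z => (u x - u (x - z)) * kern lam z) (fun z => I (x - z)) (Ioi ε) :=
      fun z hz => by
        have hz0 : 0 < z := hε.trans hz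
        exact (ek (x - z) z hz0 (by rw [sub_sub_cancel, abs_of_pos hz0])).symm
    have f₂ : EqOn (fun z => (u x - u (x + z)) * kern lam z) (fun z => I (x + z)) (Ioi ε) :=
      fun z hz => by
        have hz0 : 0 < z := hε.trans hz
        exact (ek (x + z) z hz0 (by rw [sub_add_cancel_left, abs_neg, abs_of_pos hz0])).symm
    have j₁ : IntegrableOn I (Iio (x - ε)) :=
      integrableOn_comp_const_sub.1 (s₁.1.congr_fun f₁ measurableSet_Ioi)
    have j₂ : IntegrableOn I (Ioi (x + ε)) :=
      integrableOn_comp_const_add.1 (s₂.1.congr_fun f₂ measurableSet_Ioi)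
    have e : ∫ y in {y : ℝ | ε < |x - y|}, I y =
        (∫ z in Ioi ε, (u x - u (x - z)) * kern lam z) +
          ∫ z in Ioi ε, (u x - u (x + z)) * kern lam z := by
      rw [hset, setIntegral_union _ measurableSet_Ioi j₁ j₂, setIntegral_comp_const_sub,
        setIntegral_comp_const_add, setIntegral_congr_fun measurableSet_Ioi f₁,
        setIntegral_congr_fun measurableSet_Ioi f₂]
      rw [Set.disjoint_left]
      intro y hy hy'
      simp only [mem_Iio, mem_Ioi] at hy hy'
      linarith
    have ci : ∀ {F : ℝ → ℝ}, Continuous F →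
        IntervalIntegrable (fun z => F z * kern lam z) volume ε h := by
      intro F hF
      refine (hF.continuousOn.mul ?_).intervalIntegrable
      unfold kern
      refine ContinuousOn.div (by fun_prop) (by fun_prop) fun z hz => ?_
      rw [uIcc_of_le hεh.le] at hz
      exact (pow_pos (hε.trans_le hz.1) 2).ne'
    have mid := singular_part_error (x := x) (K2 := K2) (K3 := K3) hlam hε hεh hU hU1 hU2
      (hK2 x hx) (fun z hz => hK3 z ⟨by linarith [hz.1], by linarith [hz.2]⟩)
    have em : (∫ z in ε..h, (2 * U x - U (x + z) - U (x - z)) * kern lam z) =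
        (∫ z in ε..h, (U x - U (x - z)) * kern lam z) +
          ∫ z in ε..h, (U x - U (x + z)) * kern lam z := by
      rw [← intervalIntegral.integral_add (ci (by fun_prop)) (ci (by fun_prop))]
      congr 1; ext z; ring
    rw [em] at mid
    rw [e, s₁.2, s₂.2, hT, hC, huU x hx]
    simp only [quad, sub_zero, add_zero]
    rw [abs_le] at *
    constructor <;> linarith [mid.1, mid.2, q₁.1, q₁.2, q₂.1, q₂.2]
  have hlim : Filter.Tendsto (fun ε : ℝ => C + ε * E) (nhdsWithin 0 (Ioi 0)) (nhds C) := by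
    have : Filter.Tendsto (fun ε : ℝ => C + ε * E) (nhds 0) (nhds (C + 0 * E)) :=
      (by fun_prop : Continuous fun ε : ℝ => C + ε * E).tendsto 0
    rw [zero_mul, add_zero] at this
    exact this.mono_left nhdsWithin_le_nhds
  refine le_of_tendsto_of_tendsto (hf.sub_const T).abs hlim ?_
  filter_upwards [Ioo_mem_nhdsGT hh] with ε hε
  exact key ε hε

/-- Weight of the boundary node at distance `m` from the collocation node. -/
def bdWeight (lam h : ℝ) (m : ℕ) : ℝ :=
  h⁻¹ * (if m = 1 then 1 else wβ h (m - 1)) * Real.exp (-lam * (m * h)) * (m : ℝ)⁻¹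

/-- Weight of an interior node at distance `m` from the collocation node. -/
def inWeight (lam h : ℝ) (m : ℕ) : ℝ :=
  bdWeight lam h m + h⁻¹ * wα h m * Real.exp (-lam * (m * h)) * (m : ℝ)⁻¹

theorem wα_nonneg {h : ℝ} (hh : 0 < h) (m : ℕ) : 0 ≤ wα h m := by
  have hle : (m : ℝ) * h ≤ (m + 1 : ℕ) * h := by push_cast; nlinarith
  refine mul_nonneg (inv_pos.2 hh).le (intervalIntegral.integral_nonneg hle fun z hz => ?_)
  have : 0 ≤ z := le_trans (by positivity) hz.1
  exact mul_nonneg (sub_nonneg.2 hz.2) (inv_nonneg.2 this)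

theorem wβ_nonneg {h : ℝ} (hh : 0 < h) (m : ℕ) : 0 ≤ wβ h m := by
  have hle : (m : ℝ) * h ≤ (m + 1 : ℕ) * h := by push_cast; nlinarith
  refine mul_nonneg (inv_pos.2 hh).le (intervalIntegral.integral_nonneg hle fun z hz => ?_)
  have : 0 ≤ z := le_trans (by positivity) hz.1
  exact mul_nonneg (sub_nonneg.2 hz.1) (inv_nonneg.2 this)

theorem bdWeight_nonneg {h : ℝ} (hh : 0 < h) (lam : ℝ) (m : ℕ) : 0 ≤ bdWeight lam h m := by
  have := wβ_nonneg hh (m - 1)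
  unfold bdWeight
  split_ifs <;> positivity

theorem inWeight_nonneg {h : ℝ} (hh : 0 < h) (lam : ℝ) (m : ℕ) : 0 ≤ inWeight lam h m := by
  have := bdWeight_nonneg hh lam m
  have := wα_nonneg hh m
  unfold inWeight
  positivity

/-- The quadrature written as a weighted sum of differences. -/
theorem sum_weights_eq_quad {lam h : ℝ} (hh : 0 < h) (w : ℝ → ℝ) {N : ℕ} (hN : 1 ≤ N) :
    ∑ m ∈ Finset.Ico 1 N, inWeight lam h m * (w 0 - w (m * h)) +
      bdWeight lam h N * (w 0 - w (N * h)) = quad lam h N w := by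
  induction N, hN using Nat.le_induction with
  | base => simp [quad, bdWeight, kern]; field_simp
  | succ N hN ih =>
    rw [Finset.sum_Ico_succ_top hN]
    have hq : quad lam h (N + 1) w = quad lam h N w +
        (wα h N * ((w 0 - w (N * h)) / (N * h) * Real.exp (-lam * (N * h))) +
         wβ h N * ((w 0 - w ((N + 1 : ℕ) * h)) / ((N + 1 : ℕ) * h) *
          Real.exp (-lam * ((N + 1 : ℕ) * h)))) := by
      simp only [quad]
      rw [Finset.sum_Ico_succ_top hN, add_assoc]
    have hN1 : N + 1 ≠ 1 := by omega
    have hb : bdWeight lam h (N + 1) =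
        h⁻¹ * wβ h N * Real.exp (-lam * ((N + 1 : ℕ) * h)) * ((N + 1 : ℕ) : ℝ)⁻¹ := by
      rw [bdWeight, if_neg hN1, Nat.add_sub_cancel]
    have hN0 : (N : ℝ) ≠ 0 := by positivity
    have hN2 : ((N + 1 : ℕ) : ℝ) ≠ 0 := by positivity
    rw [hq, ← ih, hb, inWeight]
    set S := ∑ m ∈ Finset.Ico 1 N, inWeight lam h m * (w 0 - w (m * h))
    field_simp
    ring

section grid

variable {a b : ℝ} {M : ℕ}

theorem gH_pos (hab : a < b) (M : ℕ) : 0 < gH a b M :=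
  div_pos (sub_pos.2 hab) (by positivity)

theorem gX_add (a b : ℝ) (M i m : ℕ) : gX a b M (i + m) = gX a b M i + m * gH a b M := by
  simp only [gX]; push_cast; ring

theorem gX_last (a b : ℝ) (M : ℕ) : gX a b M (M + 1) = b := by
  simp only [gX, gH]; push_cast; field_simp; ring

theorem gH_rpow (hab : a < b) (M : ℕ) :
    gH a b M ^ (-((1 : ℕ) : ℝ) - 1) = (gH a b M)⁻¹ * (gH a b M)⁻¹ := by
  have h := gH_pos hab M
  rw [show (-((1 : ℕ) : ℝ) - 1) = -2 by norm_num, Real.rpow_neg h.le, Real.rpow_ofNat]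
  rw [sq, mul_inv]

theorem weight_exponent (t : ℝ) : t ^ (((1 : ℕ) : ℝ) - 1 - 1) = t⁻¹ := by
  norm_num [Real.rpow_neg_one]

theorem cA3_eq (hab : a < b) (i m : ℕ) :
    cA3 a b 1 1 M i (i + m + 1) = (gH a b M)⁻¹ * wα (gH a b M) m := by
  simp only [cA3, wα, gH_rpow hab, weight_exponent, Nat.add_sub_cancel, mul_assoc]
  congr 2
  rw [add_assoc, gX_add, gX_add, ← intervalIntegral.integral_comp_add_left]
  congr 1; ext z; ring_nf

theorem cA4_eq (hab : a < b) (i m : ℕ) :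
    cA4 a b 1 1 M i (i + m + 1) = (gH a b M)⁻¹ * wβ (gH a b M) m := by
  simp only [cA4, wβ, gH_rpow hab, weight_exponent, Nat.add_sub_cancel, mul_assoc]
  congr 2
  rw [add_assoc, gX_add, gX_add, ← intervalIntegral.integral_comp_add_left]
  congr 1; ext z; ring_nf

theorem cA1_eq (hab : a < b) (j m : ℕ) :
    cA1 a b 1 1 M (j + 1 + m) (j + 1) = (gH a b M)⁻¹ * wβ (gH a b M) m := by
  simp only [cA1, wβ, gH_rpow hab, weight_exponent, Nat.add_sub_cancel, mul_assoc]
  congr 2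
  have e1 : gX a b M j = gX a b M (j + 1 + m) - (m + 1 : ℕ) * gH a b M := by
    simp only [gX]; push_cast; ring
  have e2 : gX a b M (j + 1) = gX a b M (j + 1 + m) - m * gH a b M := by
    simp only [gX]; push_cast; ring
  rw [e1, e2, ← intervalIntegral.integral_comp_sub_left]
  congr 1; ext z; ring_nf

theorem cA2_eq (hab : a < b) (j m : ℕ) :
    cA2 a b 1 1 M (j + 1 + m) (j + 1) = (gH a b M)⁻¹ * wα (gH a b M) m := by
  simp only [cA2, wα, gH_rpow hab, weight_exponent, Nat.add_sub_cancel, mul_assoc]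
  congr 2
  have e1 : gX a b M j = gX a b M (j + 1 + m) - (m + 1 : ℕ) * gH a b M := by
    simp only [gX]; push_cast; ring
  have e2 : gX a b M (j + 1) = gX a b M (j + 1 + m) - m * gH a b M := by
    simp only [gX]; push_cast; ring
  rw [e1, e2, ← intervalIntegral.integral_comp_sub_left]
  congr 1; ext z; ring_nf

theorem near_weight_eq (lam h : ℝ) :
    h ^ (-1 : ℝ) * Real.exp (-lam * h) / (((1 : ℕ) : ℝ) + 1 - 1) = bdWeight lam h 1 := by
  simp [bdWeight, Real.rpow_neg_one]

theorem left_weight_eq (hab : a < b) (lam : ℝ) {i : ℕ} (hi : 2 ≤ i) :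
    cA1 a b 1 1 M i 1 * Real.exp (-lam * i * gH a b M) * (i : ℝ) ^ (-((1 : ℕ) : ℝ)) =
      bdWeight lam (gH a b M) i := by
  obtain ⟨m, rfl⟩ : ∃ m, i = 0 + 1 + m := ⟨i - 1, by omega⟩
  have hm : m ≠ 0 := by omega
  rw [show (1 : ℕ) = 0 + 1 from rfl, cA1_eq hab, bdWeight, if_neg (by omega),
    show 0 + 1 + m - 1 = m by omega, mul_assoc (-lam)]
  simp [Real.rpow_neg_one]

theorem right_weight_eq (hab : a < b) (lam : ℝ) {i m : ℕ} (hm : 2 ≤ m) (hi : i + m = M + 1) :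
    cA4 a b 1 1 M i (M + 1) * Real.exp (-lam * m * gH a b M) * (m : ℝ) ^ (-((1 : ℕ) : ℝ)) =
      bdWeight lam (gH a b M) m := by
  obtain ⟨k, rfl⟩ : ∃ k, m = k + 1 := ⟨m - 1, by omega⟩
  rw [← hi, ← add_assoc, cA4_eq hab, bdWeight, if_neg (by omega), Nat.add_sub_cancel,
    mul_assoc (-lam)]
  simp [Real.rpow_neg_one]

theorem offD_left (hab : a < b) (lam : ℝ) {j m : ℕ} (hj : 1 ≤ j) (hm : 1 ≤ m) :
    offD a b 1 lam 1 1 M (j + m) j = -inWeight lam (gH a b M) m := by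
  obtain ⟨j, rfl⟩ : ∃ k, j = k + 1 := ⟨j - 1, by omega⟩
  obtain ⟨m, rfl⟩ : ∃ k, m = k + 1 := ⟨m - 1, by omega⟩
  unfold offD
  rcases Nat.eq_zero_or_pos m with rfl | hm0
  · rw [if_neg (by omega), if_pos (by omega), near_weight_eq, Nat.add_sub_cancel, zero_add,
      cA2_eq hab j 1, inWeight]
    simp; ring
  · rw [if_pos (by omega), show j + 1 + (m + 1) = j + 1 + 1 + m by omega,
      cA1_eq hab (j + 1) m, show j + 1 + 1 + m = j + 1 + (m + 1) by omega,
      cA2_eq hab j (m + 1), inWeight, bdWeight, if_neg (by omega), Nat.add_sub_cancel]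
    rw [show (((j + 1 + (m + 1) : ℕ) : ℝ) - ((j + 1 : ℕ) : ℝ)) = ((m + 1 : ℕ) : ℝ) by
      push_cast; ring, mul_assoc (-lam), Nat.cast_one, Real.rpow_neg_one]
    ring

theorem offD_right (hab : a < b) (lam : ℝ) {i m : ℕ} (hm : 1 ≤ m) :
    offD a b 1 lam 1 1 M i (i + m) = -inWeight lam (gH a b M) m := by
  obtain ⟨m, rfl⟩ : ∃ k, m = k + 1 := ⟨m - 1, by omega⟩
  unfold offD
  rcases Nat.eq_zero_or_pos m with rfl | hm0
  · rw [if_neg (by omega), if_neg (by omega), if_pos (by omega), near_weight_eq,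
      cA3_eq hab i 1, inWeight]
    simp; ring
  · rw [if_neg (by omega), if_neg (by omega), if_neg (by omega), if_pos (by omega),
      cA3_eq hab i (m + 1), ← add_assoc, cA4_eq hab i m, inWeight, bdWeight,
      if_neg (by omega), Nat.add_sub_cancel]
    rw [show (((i + m + 1 : ℕ) : ℝ) - (i : ℝ)) = ((m + 1 : ℕ) : ℝ) by
      push_cast; ring, mul_assoc (-lam), Nat.cast_one, Real.rpow_neg_one]
    ring

theorem diagExtra_eq (hab : a < b) (lam : ℝ) (hM : 3 ≤ M) {i : ℕ} (hi : 1 ≤ i) (hiM : i ≤ M) :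
    diagExtra a b 1 lam 1 1 M i =
      bdWeight lam (gH a b M) i + bdWeight lam (gH a b M) (M + 1 - i) := by
  unfold diagExtra
  split_ifs with h1 h2
  · subst h1
    rw [near_weight_eq, right_weight_eq hab lam (by omega) (by omega), Nat.add_sub_cancel]
  · subst h2
    rw [near_weight_eq, left_weight_eq hab lam (by omega), show i + 1 - i = 1 by omega, add_comm]
  · rw [left_weight_eq hab lam (by omega), show ((M : ℝ) + 1 - i) = ((M + 1 - i : ℕ) : ℝ) by
      push_cast [Nat.cast_sub (by omega : i ≤ M + 1)]; ring,
      right_weight_eq hab lam (by omega) (by omega)]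

theorem cB1_eq (lam : ℝ) (hab : a < b) {i : ℕ} (hi : 1 ≤ i) :
    cB1 a b 1 lam M i = ∫ z in Ioi (i * gH a b M), kern lam z := by
  have hh := gH_pos hab M
  have hp : 0 < (i : ℝ) * gH a b M := by positivity
  have ha : a = gX a b M i - i * gH a b M := by simp [gX]
  unfold cB1
  rw [show Iio a = Iio (gX a b M i - i * gH a b M) from congrArg Iio ha]
  rw [setIntegral_comp_const_sub]
  refine setIntegral_congr_fun measurableSet_Ioi fun z hz => ?_
  have hz0 : 0 < z := hp.trans hz
  simp only [sub_sub_cancel, kern]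
  rw [show (-1 - 1 : ℝ) = -2 by norm_num, Real.rpow_neg hz0.le, Real.rpow_ofNat, div_eq_mul_inv]
  ring_nf

theorem gX_add_eq_right {i m : ℕ} (h : i + m = M + 1) : b = gX a b M i + m * gH a b M := by
  rw [← gX_add, h, gX_last]

theorem cB2_eq (lam : ℝ) (hab : a < b) {i m : ℕ} (hm : 1 ≤ m) (h : i + m = M + 1) :
    cB2 a b 1 lam M i = ∫ z in Ioi (m * gH a b M), kern lam z := by
  have hh := gH_pos hab M
  have hp : 0 < (m : ℝ) * gH a b M := by positivity
  unfold cB2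
  nth_rewrite 1 [gX_add_eq_right (a := a) (b := b) h]
  rw [setIntegral_comp_const_add]
  refine setIntegral_congr_fun measurableSet_Ioi fun z hz => ?_
  have hz0 : 0 < z := hp.trans hz
  simp only [add_sub_cancel_left, sub_add_cancel_left, kern]
  rw [show (-1 - 1 : ℝ) = -2 by norm_num, Real.rpow_neg hz0.le, Real.rpow_ofNat, div_eq_mul_inv]
  ring_nf

theorem dd1_eq (lam : ℝ) (g : ℝ → ℝ) (hab : a < b) {i : ℕ} (hi : 1 ≤ i) :
    dd1 a b 1 lam g M i = ∫ z in Ioi (i * gH a b M), g (gX a b M i - z) * kern lam z := by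
  have hh := gH_pos hab M
  have hp : 0 < (i : ℝ) * gH a b M := by positivity
  have ha : a = gX a b M i - i * gH a b M := by simp [gX]
  unfold dd1
  rw [show Iio a = Iio (gX a b M i - i * gH a b M) from congrArg Iio ha]
  rw [setIntegral_comp_const_sub]
  refine setIntegral_congr_fun measurableSet_Ioi fun z hz => ?_
  have hz0 : 0 < z := hp.trans hz
  simp only [sub_sub_cancel, kern]
  rw [show (-1 - 1 : ℝ) = -2 by norm_num, Real.rpow_neg hz0.le, Real.rpow_ofNat, div_eq_mul_inv]
  ring_nf

theorem dd2_eq (lam : ℝ) (g : ℝ → ℝ) (hab : a < b) {i m : ℕ} (hm : 1 ≤ m) (h : i + m = M + 1) :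
    dd2 a b 1 lam g M i = ∫ z in Ioi (m * gH a b M), g (gX a b M i + z) * kern lam z := by
  have hh := gH_pos hab M
  have hp : 0 < (m : ℝ) * gH a b M := by positivity
  unfold dd2
  nth_rewrite 1 [gX_add_eq_right (a := a) (b := b) h]
  rw [setIntegral_comp_const_add]
  refine setIntegral_congr_fun measurableSet_Ioi fun z hz => ?_
  have hz0 : 0 < z := hp.trans hz
  simp only [add_sub_cancel_left, kern]
  rw [show (-1 - 1 : ℝ) = -2 by norm_num, Real.rpow_neg hz0.le, Real.rpow_ofNat, div_eq_mul_inv]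
  ring_nf

end grid

theorem offD_nonpos {a b lam : ℝ} {M : ℕ} (hab : a < b) {i j : ℕ} (hj : 1 ≤ j) (hij : i ≠ j) :
    offD a b 1 lam 1 1 M i j ≤ 0 := by
  have hw := fun m => inWeight_nonneg (gH_pos hab M) lam m
  rcases lt_or_gt_of_ne hij with h | h
  · obtain ⟨m, rfl⟩ := Nat.exists_eq_add_of_lt h
    rw [add_assoc, offD_right hab lam (by omega)]
    exact neg_nonpos.2 (hw _)
  · obtain ⟨m, rfl⟩ := Nat.exists_eq_add_of_lt h
    rw [add_assoc, offD_left hab lam hj (by omega)]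
    exact neg_nonpos.2 (hw _)

/-- The mass of the kernel outside `(a, b)`, seen from the `i`-th node. -/
def tailMass (lam h : ℝ) (M i : ℕ) : ℝ :=
  (∫ z in Ioi (i * h), kern lam z) + ∫ z in Ioi ((M + 1 - i : ℕ) * h), kern lam z

theorem stiff_mulVec_apply {a b lam : ℝ} {M : ℕ} (hab : a < b) (hM : 3 ≤ M) (v : Fin M → ℝ)
    (i : Fin M) :
    (stiff a b 1 lam 1 1 M).mulVec v i =
      (tailMass lam (gH a b M) M (i.val + 1) + bdWeight lam (gH a b M) (i.val + 1) +
        bdWeight lam (gH a b M) (M + 1 - (i.val + 1))) * v i +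
      ∑ k ∈ Finset.univ.erase i, -offD a b 1 lam 1 1 M (i.val + 1) (k.val + 1) * (v i - v k) := by
  have hi := i.isLt
  rw [Matrix.mulVec, dotProduct, ← Finset.add_sum_erase _ _ (Finset.mem_univ i)]
  have h1 : ∑ k ∈ Finset.univ.erase i, stiff a b 1 lam 1 1 M i k * v k =
      ∑ k ∈ Finset.univ.erase i, offD a b 1 lam 1 1 M (i.val + 1) (k.val + 1) * v k :=
    Finset.sum_congr rfl fun k hk => by
      rw [stiff, if_neg (Finset.ne_of_mem_erase hk).symm]
  have h2 : ∑ k ∈ Finset.univ.erase i,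
      -offD a b 1 lam 1 1 M (i.val + 1) (k.val + 1) * (v i - v k) =
      -((∑ k ∈ Finset.univ.erase i, offD a b 1 lam 1 1 M (i.val + 1) (k.val + 1)) * v i) +
      ∑ k ∈ Finset.univ.erase i, offD a b 1 lam 1 1 M (i.val + 1) (k.val + 1) * v k := by
    rw [Finset.sum_mul, ← Finset.sum_neg_distrib, ← Finset.sum_add_distrib]
    exact Finset.sum_congr rfl fun k _ => by ring
  rw [h1, h2, stiff, if_pos rfl, diagExtra_eq hab lam hM (by omega) (by omega),
    cB1_eq lam hab (by omega),
    cB2_eq lam hab (m := M + 1 - (i.val + 1)) (by omega) (by omega), tailMass]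
  ring

theorem stiff_mulVec_grid {a b lam : ℝ} {M : ℕ} (hab : a < b) (hM : 3 ≤ M) (v : ℕ → ℝ)
    (i : Fin M) {n : ℕ} (hn : i.val + 1 + n = M + 1) :
    (stiff a b 1 lam 1 1 M).mulVec (fun k => v (k.val + 1)) i =
      (tailMass lam (gH a b M) M (i.val + 1) + bdWeight lam (gH a b M) (i.val + 1) +
        bdWeight lam (gH a b M) n) * v (i.val + 1) +
      ∑ m ∈ Finset.Ico 1 (i.val + 1),
        inWeight lam (gH a b M) m * (v (i.val + 1) - v (i.val + 1 - m)) +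
      ∑ m ∈ Finset.Ico 1 n, inWeight lam (gH a b M) m * (v (i.val + 1) - v (i.val + 1 + m)) := by
  have hi := i.isLt
  rw [stiff_mulVec_apply hab hM, show M + 1 - (i.val + 1) = n by omega, add_assoc _ (Finset.sum _ _)]
  congr 1
  set I := i.val + 1 with hI
  set F : ℕ → ℝ := fun j => -offD a b 1 lam 1 1 M I j * (v I - v j) with hF
  have e0 : ∑ k ∈ Finset.univ.erase i, -offD a b 1 lam 1 1 M I (k.val + 1) * (v I - v (k.val + 1)) =
      ∑ j ∈ Finset.Ico 1 (M + 1), F j := by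
    rw [Finset.sum_erase _ (by simp [← hI]), Finset.sum_Ico_eq_sum_range, ← Fin.sum_univ_eq_sum_range
      (fun k => F (1 + k)) (M + 1 - 1)]
    exact Finset.sum_congr rfl fun k _ => by simp only [hF, add_comm]
  rw [e0, ← Finset.sum_Ico_consecutive F (by omega : 1 ≤ I) (by omega : I ≤ M + 1),
    Finset.sum_eq_sum_Ico_succ_bot (by omega : I < M + 1)]
  have e1 : F I = 0 := by simp [hF]
  have e2 : ∑ j ∈ Finset.Ico 1 I, F j =
      ∑ m ∈ Finset.Ico 1 I, inWeight lam (gH a b M) m * (v I - v (I - m)) := by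
    refine Finset.sum_nbij' (fun j => I - j) (fun m => I - m) ?_ ?_ ?_ ?_ ?_
    all_goals intro j hj; simp only [Finset.mem_Ico] at hj ⊢
    any_goals omega
    have h := offD_left (M := M) hab lam (j := j) (m := I - j) hj.1 (by omega)
    rw [show j + (I - j) = I by omega] at h
    rw [show I - (I - j) = j by omega]
    simp only [hF, h, neg_neg]
  have e3 : ∑ j ∈ Finset.Ico (I + 1) (M + 1), F j =
      ∑ m ∈ Finset.Ico 1 n, inWeight lam (gH a b M) m * (v I - v (I + m)) := by
    rw [← hn, add_comm I 1, add_comm I n, ← Finset.sum_Ico_add' F 1 n I]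
    refine Finset.sum_congr rfl fun m hm => ?_
    have hm1 : 1 ≤ m := (Finset.mem_Ico.1 hm).1
    simp only [hF, add_comm m I, offD_right hab lam hm1, neg_neg]
  rw [e1, e2, e3, zero_add]

theorem loadF_apply {a b lam : ℝ} {M : ℕ} (hab : a < b) (f g u : ℝ → ℝ)
    (i : Fin M) {n : ℕ} (hn : i.val + 1 + n = M + 1) :
    loadF a b 1 lam 1 1 f g u M i =
      f (gX a b M (i.val + 1)) +
      (∫ z in Ioi ((i.val + 1 : ℕ) * gH a b M), g (gX a b M (i.val + 1) - z) * kern lam z) +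
      (∫ z in Ioi (n * gH a b M), g (gX a b M (i.val + 1) + z) * kern lam z) +
      bdWeight lam (gH a b M) (i.val + 1) * u a + bdWeight lam (gH a b M) n * u b := by
  have hi := i.isLt
  have hc : (M : ℝ) - (i.val : ℝ) = (n : ℝ) := by
    have : ((i.val + 1 + n : ℕ) : ℝ) = ((M + 1 : ℕ) : ℝ) := by rw [hn]
    push_cast at this; linarith
  unfold loadF
  rw [dd1_eq lam g hab (by omega), dd2_eq lam g hab (by omega) hn]
  congr 3
  · split_ifs with h
    · rw [near_weight_eq, h]
    · rw [← Nat.cast_succ, Nat.succ_eq_add_one, left_weight_eq hab lam (by omega)]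
  · split_ifs with h
    · rw [near_weight_eq, show n = 1 by omega]
    · rw [hc, right_weight_eq hab lam (by omega) hn]

/-- Maximum-norm stability of the scheme. -/
theorem stiff_stability {a b lam : ℝ} {M : ℕ} (hab : a < b) (hlam : 0 ≤ lam) (hM : 3 ≤ M)
    (v : Fin M → ℝ) {ρ : ℝ} (hρ : ∀ i, |(stiff a b 1 lam 1 1 M).mulVec v i| ≤ ρ) (i : Fin M) :
    |v i| ≤ (kern lam (b - a + 1))⁻¹ * ρ := by
  have hh := gH_pos hab M
  have hc : 0 < kern lam (b - a + 1) := by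
    have : 0 < b - a + 1 := by linarith
    unfold kern; positivity
  obtain ⟨j, -, hj⟩ := Finset.exists_max_image Finset.univ (fun k => |v k|) ⟨i, Finset.mem_univ i⟩
  refine (hj i (Finset.mem_univ i)).trans ?_
  rw [le_inv_mul_iff₀ hc]
  have hjM := j.isLt
  have hL : ((j.val + 1 : ℕ) : ℝ) * gH a b M ≤ b - a := by
    rw [gH, mul_div_assoc', div_le_iff₀ (by positivity), mul_comm]
    have : ((j.val + 1 : ℕ) : ℝ) ≤ (M : ℝ) + 1 := by exact_mod_cast (by omega : j.val + 1 ≤ M + 1)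
    exact mul_le_mul_of_nonneg_left this (by linarith)
  have ht : kern lam (b - a + 1) ≤ tailMass lam (gH a b M) M (j.val + 1) :=
    (le_integral_kern hlam (by positivity) hL).trans
      (le_add_of_nonneg_right (integral_nonneg fun z => kern_nonneg _ _))
  have h1 := bdWeight_nonneg hh lam (j.val + 1)
  have h2 := bdWeight_nonneg hh lam (M + 1 - (j.val + 1))
  have hS : 0 ≤ v j * ∑ k ∈ Finset.univ.erase j,
      -offD a b 1 lam 1 1 M (j.val + 1) (k.val + 1) * (v j - v k) := by
    rw [Finset.mul_sum]
    refine Finset.sum_nonneg fun k hk => ?_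
    have hne : j.val + 1 ≠ k.val + 1 := fun h =>
      Finset.ne_of_mem_erase hk (Fin.ext (by omega)).symm
    have ho := offD_nonpos (lam := lam) (M := M) hab (j := k.val + 1) (by omega) hne
    have hv : 0 ≤ v j * (v j - v k) := by
      have hk' := hj k (Finset.mem_univ k)
      have : v j * v k ≤ |v j| * |v j| := by
        calc v j * v k ≤ |v j * v k| := le_abs_self _
          _ = |v j| * |v k| := abs_mul _ _
          _ ≤ _ := by gcongr
      rw [abs_mul_abs_self] at this
      linarith
    calc (0 : ℝ) ≤ -offD a b 1 lam 1 1 M (j.val + 1) (k.val + 1) * (v j * (v j - v k)) :=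
          mul_nonneg (neg_nonneg.2 ho) hv
      _ = _ := by ring
  have hrow := stiff_mulVec_apply (lam := lam) hab hM v j
  have hm : kern lam (b - a + 1) * (|v j| * |v j|) ≤
      |v j| * |(stiff a b 1 lam 1 1 M).mulVec v j| := by
    rw [abs_mul_abs_self, ← abs_mul, hrow]
    refine le_trans ?_ (le_abs_self _)
    have hsq := mul_self_nonneg (v j)
    rw [mul_add]
    have : kern lam (b - a + 1) * (v j * v j) ≤ (tailMass lam (gH a b M) M (j.val + 1) +
        bdWeight lam (gH a b M) (j.val + 1) +
        bdWeight lam (gH a b M) (M + 1 - (j.val + 1))) * (v j * v j) :=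
      mul_le_mul_of_nonneg_right (by linarith) hsq
    linarith
  rcases eq_or_ne (|v j|) 0 with h0 | h0
  · rw [h0, mul_zero]
    exact (abs_nonneg _).trans (hρ j)
  · have hpos : 0 < |v j| := lt_of_le_of_ne (abs_nonneg _) h0.symm
    refine le_trans ?_ (hρ j)
    refine le_of_mul_le_mul_left ?_ hpos
    linarith

theorem stiff_existsUnique {a b lam : ℝ} {M : ℕ} (hab : a < b) (hlam : 0 ≤ lam) (hM : 3 ≤ M)
    (F : Fin M → ℝ) : ∃! v : Fin M → ℝ, (stiff a b 1 lam 1 1 M).mulVec v = F := by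
  have hinj : Function.Injective (stiff a b 1 lam 1 1 M).mulVecLin := by
    rw [injective_iff_map_eq_zero]
    intro v hv
    ext i
    have := stiff_stability hab hlam hM v (ρ := 0) (fun k => by
      have := congrFun hv k
      rw [Matrix.mulVecLin_apply] at this
      simp [this]) i
    rw [mul_zero] at this
    exact abs_nonpos_iff.1 this
  exact Function.Bijective.existsUnique
    (f := (stiff a b 1 lam 1 1 M).mulVecLin) ⟨hinj, LinearMap.injective_iff_surjective.1 hinj⟩ F

theorem gH_mul_succ (a b : ℝ) (M : ℕ) : ((M : ℝ) + 1) * gH a b M = b - a := by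
  rw [gH]; field_simp

theorem dnorm2_le {a b : ℝ} {M : ℕ} (hab : a < b) {v : Fin M → ℝ} {ρ : ℝ} (hρ : 0 ≤ ρ)
    (hv : ∀ i, |v i| ≤ ρ) : dnorm2 a b M v ≤ Real.sqrt (b - a) * ρ := by
  have hh := gH_pos hab M
  have hs : ∑ i, v i ^ 2 ≤ M * ρ ^ 2 := by
    calc ∑ i, v i ^ 2 ≤ ∑ _i : Fin M, ρ ^ 2 := Finset.sum_le_sum fun i _ => by
          rw [← sq_abs]; exact pow_le_pow_left₀ (abs_nonneg _) (hv i) 2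
      _ = _ := by simp
  rw [dnorm2, ← Real.sqrt_sq hρ, ← Real.sqrt_mul (sub_pos.2 hab).le]
  refine Real.sqrt_le_sqrt ?_
  calc gH a b M * ∑ i, v i ^ 2 ≤ gH a b M * (M * ρ ^ 2) := by gcongr
    _ ≤ ((M : ℝ) + 1) * gH a b M * ρ ^ 2 := by nlinarith [sq_nonneg ρ]
    _ = _ := by rw [gH_mul_succ]

/-- The grid spacings below one are bounded away from one. -/
theorem exists_pos_le_abs_log_gH {a b : ℝ} (hab : a < b) :
    ∃ q > 0, ∀ M : ℕ, gH a b M < 1 → q ≤ |Real.log (gH a b M)| := by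
  classical
  by_cases hex : ∃ M : ℕ, gH a b M < 1
  · have h0 := gH_pos hab (Nat.find hex)
    have h1 := Nat.find_spec hex
    have hl := Real.log_neg h0 h1
    refine ⟨|Real.log (gH a b (Nat.find hex))|, abs_pos.2 hl.ne, fun M hM => ?_⟩
    have hle : gH a b M ≤ gH a b (Nat.find hex) := by
      have := sub_pos.2 hab
      unfold gH; gcongr
      exact Nat.find_min' hex hM
    have := Real.log_le_log (gH_pos hab M) hle
    rw [abs_of_neg hl, abs_of_neg (by linarith)]
    linarith
  · exact ⟨1, one_pos, fun M hM => absurd ⟨M, hM⟩ hex⟩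

/-- Consistency of the scheme at one node, in terms of bounds on the derivatives of an extension
of `u`. -/
theorem truncation_error_le {a b lam : ℝ} {u g f U U1 U2 U3 : ℝ → ℝ} {K1 K2 K3 : ℝ}
    (hab : a < b) (hlam : 0 ≤ lam) (hg : Measurable g)
    (hug : ∀ x, x ∉ Ioo a b → u x = g x)
    (hgint : ∀ x ∈ Ioo a b,
      IntegrableOn (fun y => |g y| * Real.exp (-lam * |x - y|) * |x - y| ^ (-1 - 1 : ℝ))
        (Ioo a b)ᶜ volume)
    (hf : ∀ x ∈ Ioo a b,
      Filter.Tendsto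
        (fun ε : ℝ => ∫ y in {y : ℝ | ε < |x - y|},
          (u x - u y) * Real.exp (-lam * |x - y|) * |x - y| ^ (-1 - 1 : ℝ))
        (nhdsWithin 0 (Ioi 0)) (nhds (f x)))
    (huU : ∀ z ∈ Icc a b, U z = u z)
    (hU : ∀ z, HasDerivAt U (U1 z) z) (hU1 : ∀ z, HasDerivAt U1 (U2 z) z)
    (hU2 : ∀ z, HasDerivAt U2 (U3 z) z)
    (hK1 : ∀ z ∈ Icc a b, |U1 z| ≤ K1) (hK2 : ∀ z ∈ Icc a b, |U2 z| ≤ K2)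
    (hK3 : ∀ z ∈ Icc a b, |U3 z| ≤ K3) {M : ℕ} (hM : 3 ≤ M) (i : Fin M) :
    |(stiff a b 1 lam 1 1 M).mulVec (fun k => u (gX a b M (k.val + 1))) i -
      loadF a b 1 lam 1 1 f g u M i| ≤
      (K2 * lam + 4 * K3) * gH a b M ^ 2 +
      (K3 + 2 * lam * K2 + lam ^ 2 * K1) * gH a b M ^ 2 * (2 * Real.log ((b - a) / gH a b M)) := by
  have hi := i.isLt
  obtain ⟨n, hn⟩ : ∃ n, i.val + 1 + n = M + 1 := ⟨M - i.val, by omega⟩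
  have hn1 : 1 ≤ n := by omega
  rw [stiff_mulVec_grid hab hM (fun k => u (gX a b M k)) i hn, loadF_apply hab f g u i hn, tailMass,
    show M + 1 - (i.val + 1) = n by omega]
  set I := i.val + 1 with hI
  have hI1 : 1 ≤ I := by omega
  set h := gH a b M with hh'
  have hh : 0 < h := gH_pos hab M
  set x := gX a b M I with hx
  have ha : x - I * h = a := by rw [hx, hh']; simp [gX]
  have hb : x + n * h = b := by rw [hx, ← gX_add, hn, gX_last]
  have hIh : 0 < (I : ℝ) * h := by positivity
  have hnh : 0 < (n : ℝ) * h := by positivity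
  have hxm : x ∈ Ioo a b := ⟨by linarith, by linarith⟩
  have habs : (fun y => |g y| * Real.exp (-lam * |x - y|) * |x - y| ^ (-1 - 1 : ℝ)) =
      fun y => |g y| * kern lam |x - y| := by
    ext y
    rw [kern, show (-1 - 1 : ℝ) = -2 by norm_num, Real.rpow_neg (abs_nonneg _), Real.rpow_ofNat,
      mul_assoc, div_eq_mul_inv]
  have hint := hgint x hxm
  rw [habs] at hint
  have mk : Measurable (kern lam) := by unfold kern; fun_prop
  have hi₁ : IntegrableOn (fun z => g (x - z) * kern lam z) (Ioi (I * h)) := by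
    have h1 : IntegrableOn (fun y => |g y| * kern lam |x - y|) (Iio (x - I * h)) :=
      hint.mono_set fun y hy hy' => by rw [ha] at hy; exact lt_asymm hy hy'.1
    refine (integrableOn_comp_const_sub.2 h1).mono' (by fun_prop) ?_
    filter_upwards [ae_restrict_mem measurableSet_Ioi] with z hz
    rw [norm_mul, Real.norm_eq_abs, Real.norm_eq_abs, abs_of_nonneg (kern_nonneg _ _),
      sub_sub_cancel, abs_of_pos (hIh.trans hz)]
  have hi₂ : IntegrableOn (fun z => g (x + z) * kern lam z) (Ioi (n * h)) := by
    have h1 : IntegrableOn (fun y => |g y| * kern lam |x - y|) (Ioi (x + n * h)) :=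
      hint.mono_set fun y hy hy' => by rw [hb] at hy; exact lt_asymm hy hy'.2
    refine (integrableOn_comp_const_add.2 h1).mono' (by fun_prop) ?_
    filter_upwards [ae_restrict_mem measurableSet_Ioi] with z hz
    rw [norm_mul, Real.norm_eq_abs, Real.norm_eq_abs, abs_of_nonneg (kern_nonneg _ _),
      sub_add_cancel_left, abs_neg, abs_of_pos (hnh.trans hz)]
  have c₁ : EqOn (fun z => g (x - z) * kern lam z) (fun z => u (x - z) * kern lam z)
      (Ioi (I * h)) := fun z hz => by
    have hz' : (I : ℝ) * h < z := hz
    simp only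
    rw [hug (x - z) fun hm => by linarith [hm.1]]
  have c₂ : EqOn (fun z => g (x + z) * kern lam z) (fun z => u (x + z) * kern lam z)
      (Ioi (n * h)) := fun z hz => by
    have hz' : (n : ℝ) * h < z := hz
    simp only
    rw [hug (x + z) fun hm => by linarith [hm.2]]
  have main := principal_value_quad_error (u := u) (x := x) (n₁ := I) (n₂ := n) hlam hh hI1 hn1
    hU hU1 hU2 (by rwa [ha, hb]) (by rwa [ha, hb]) (by rwa [ha, hb])
    (by rw [ha, hb]; exact fun z hz => (huU z hz).symm)
    (hi₁.congr_fun c₁ measurableSet_Ioi) (hi₂.congr_fun c₂ measurableSet_Ioi) (hf x hxm)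
  rw [← setIntegral_congr_fun measurableSet_Ioi c₁,
    ← setIntegral_congr_fun measurableSet_Ioi c₂, ← sum_weights_eq_quad hh _ hI1,
    ← sum_weights_eq_quad hh _ hn1] at main
  simp only [sub_zero, add_zero, ha, hb] at main
  have ua : U a = u a := huU a ⟨le_rfl, hab.le⟩
  have ub : U b = u b := huU b ⟨hab.le, le_rfl⟩
  have ux : U x = u x := huU x (Ioo_subset_Icc_self hxm)
  have s₁ : ∑ m ∈ Finset.Ico 1 I, inWeight lam h m * (U x - U (x - m * h)) =
      ∑ m ∈ Finset.Ico 1 I, inWeight lam h m * (u x - u (gX a b M (I - m))) := by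
    refine Finset.sum_congr rfl fun m hm => ?_
    rw [Finset.mem_Ico] at hm
    have hmI : (m : ℝ) ≤ I := by exact_mod_cast hm.2.le
    have e : gX a b M (I - m) = x - m * h := by
      simp only [hx, gX]; rw [Nat.cast_sub hm.2.le]; ring
    have hle : (m : ℝ) * h ≤ I * h := by gcongr
    have h0 : 0 ≤ (m : ℝ) * h := by positivity
    rw [e, ux, huU _ ⟨by linarith, by linarith [hxm.2]⟩]
  have s₂ : ∑ m ∈ Finset.Ico 1 n, inWeight lam h m * (U x - U (x + m * h)) =
      ∑ m ∈ Finset.Ico 1 n, inWeight lam h m * (u x - u (gX a b M (I + m))) := by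
    refine Finset.sum_congr rfl fun m hm => ?_
    rw [Finset.mem_Ico] at hm
    have hmI : (m : ℝ) ≤ n := by exact_mod_cast hm.2.le
    have hle : (m : ℝ) * h ≤ n * h := by gcongr
    have h0 : 0 ≤ (m : ℝ) * h := by positivity
    rw [gX_add, ux, huU _ ⟨by linarith [hxm.1], by linarith⟩]
  rw [s₁, s₂, ua, ub, ux, abs_sub_comm] at main
  have hlog : ∀ k : ℕ, 1 ≤ k → k ≤ M + 1 → Real.log k ≤ Real.log ((b - a) / h) := by
    intro k hk hkM
    have e : (b - a) / h = (M : ℝ) + 1 := by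
      rw [← gH_mul_succ a b M, ← hh', mul_div_cancel_right₀ _ hh.ne']
    rw [e]
    exact Real.log_le_log (by exact_mod_cast hk) (by exact_mod_cast hkM)
  have hK : 0 ≤ (K3 + 2 * lam * K2 + lam ^ 2 * K1) * h ^ 2 := by
    have k1 := (abs_nonneg _).trans (hK1 a ⟨le_rfl, hab.le⟩)
    have k2 := (abs_nonneg _).trans (hK2 a ⟨le_rfl, hab.le⟩)
    have k3 := (abs_nonneg _).trans (hK3 a ⟨le_rfl, hab.le⟩)
    positivity
  refine le_trans (le_of_eq ?_) (main.trans ?_)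
  · congr 1; ring
  · gcongr
    linarith [hlog I hI1 (by omega), hlog n hn1 (by omega)]

theorem exists_truncation_bound {a b lam : ℝ} {u g f : ℝ → ℝ}
    (hab : a < b) (hlam : 0 ≤ lam) (hu : ContDiffOn ℝ 3 u (Icc a b)) (hg : Measurable g)
    (hug : ∀ x, x ∉ Ioo a b → u x = g x)
    (hgint : ∀ x ∈ Ioo a b,
      IntegrableOn (fun y => |g y| * Real.exp (-lam * |x - y|) * |x - y| ^ (-1 - 1 : ℝ))
        (Ioo a b)ᶜ volume)
    (hf : ∀ x ∈ Ioo a b,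
      Filter.Tendsto
        (fun ε : ℝ => ∫ y in {y : ℝ | ε < |x - y|},
          (u x - u y) * Real.exp (-lam * |x - y|) * |x - y| ^ (-1 - 1 : ℝ))
        (nhdsWithin 0 (Ioi 0)) (nhds (f x))) :
    ∃ C > 0, ∀ M : ℕ, 3 ≤ M → gH a b M < 1 → ∀ i : Fin M,
      |(stiff a b 1 lam 1 1 M).mulVec (fun k => u (gX a b M (k.val + 1))) i -
        loadF a b 1 lam 1 1 f g u M i| ≤ C * |Real.log (gH a b M)| * gH a b M ^ 2 := by
  obtain ⟨U, U1, U2, U3, huU, hU, hU1, hU2, c3⟩ := exists_C3_extension hab hu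
  have cd : ∀ {F F' : ℝ → ℝ}, (∀ z, HasDerivAt F (F' z) z) → Continuous F := fun h =>
    continuous_iff_continuousAt.2 fun z => (h z).continuousAt
  have bd : ∀ {F : ℝ → ℝ}, Continuous F → ∃ K, ∀ z ∈ Icc a b, |F z| ≤ K := fun hF =>
    isCompact_Icc.exists_bound_of_continuousOn hF.continuousOn
  obtain ⟨K1, hK1⟩ := bd (cd hU1)
  obtain ⟨K2, hK2⟩ := bd (cd hU2)
  obtain ⟨K3, hK3⟩ := bd c3
  obtain ⟨q, hq, hqM⟩ := exists_pos_le_abs_log_gH hab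
  have k1 := (abs_nonneg _).trans (hK1 a ⟨le_rfl, hab.le⟩)
  have k2 := (abs_nonneg _).trans (hK2 a ⟨le_rfl, hab.le⟩)
  have k3 := (abs_nonneg _).trans (hK3 a ⟨le_rfl, hab.le⟩)
  set K := K3 + 2 * lam * K2 + lam ^ 2 * K1 with hK
  have hK0 : 0 ≤ K := by positivity
  set A := K2 * lam + 4 * K3 + 2 * K * |Real.log (b - a)| with hA
  have hA0 : 0 ≤ A := by positivity
  refine ⟨A / q + 2 * K + 1, by positivity, fun M hM hM1 i => ?_⟩
  have ht := truncation_error_le hab hlam hg hug hgint hf huU hU hU1 hU2 hK1 hK2 hK3 hM i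
  have hh := gH_pos hab M
  refine ht.trans ?_
  rw [Real.log_div (sub_pos.2 hab).ne' hh.ne']
  set h := gH a b M
  have hAq : A ≤ A / q * |Real.log h| := by
    rw [div_mul_eq_mul_div, le_div_iff₀ hq]
    exact mul_le_mul_of_nonneg_left (hqM M hM1) hA0
  have hl : Real.log (b - a) - Real.log h ≤ |Real.log (b - a)| + |Real.log h| := by
    linarith [le_abs_self (Real.log (b - a)), neg_abs_le (Real.log h)]
  calc (K2 * lam + 4 * K3) * h ^ 2 + K * h ^ 2 * (2 * (Real.log (b - a) - Real.log h))
      ≤ (K2 * lam + 4 * K3) * h ^ 2 +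
        K * h ^ 2 * (2 * (|Real.log (b - a)| + |Real.log h|)) := by gcongr
    _ = (A + 2 * K * |Real.log h|) * h ^ 2 := by rw [hA]; ring
    _ ≤ (A / q * |Real.log h| + 2 * K * |Real.log h| + |Real.log h|) * h ^ 2 := by
        refine mul_le_mul_of_nonneg_right ?_ (sq_nonneg h)
        linarith [abs_nonneg (Real.log h)]
    _ = _ := by ring

/-- convergence of the finite difference scheme, borderline case `β = 1`,
`s = s₁ = 1`, `u ∈ C³([a,b])`: there are constants `C₁, C₂ > 0`, independent of `M` and `h`,
such that for every `M ≥ 3` with `h = (b−a)/(M+1) < 1`, the system `H U_h = F` has a unique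
solution `U_h`, with `‖U − U_h‖ ≤ C₁ |ln h| h²` and `‖U − U_h‖_∞ ≤ C₂ |ln h| h²`. -/
theorem scheme_convergence_beta_one_s1 (a b β lam : ℝ)
    (hab : a < b) (hβ : β = (1 : ℝ)) (hlam : 0 ≤ lam)
    (u g f : ℝ → ℝ)
    (hu : ContDiffOn ℝ 3 u (Set.Icc a b))
    (hg : Measurable g)
    (hug : ∀ x, x ∉ Set.Ioo a b → u x = g x)
    (hgint : ∀ x ∈ Set.Ioo a b,
      IntegrableOn (fun y => |g y| * Real.exp (-lam * |x - y|) * |x - y| ^ (-1 - β))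
        (Set.Ioo a b)ᶜ volume)
    (hf : ∀ x ∈ Set.Ioo a b,
      Filter.Tendsto
        (fun ε : ℝ => ∫ y in {y : ℝ | ε < |x - y|},
          (u x - u y) * Real.exp (-lam * |x - y|) * |x - y| ^ (-1 - β))
        (nhdsWithin 0 (Set.Ioi 0)) (nhds (f x))) :
    ∃ C₁ > (0 : ℝ), ∃ C₂ > (0 : ℝ), ∀ M : ℕ, 3 ≤ M → gH a b M < 1 →
      (∃! Uh : Fin M → ℝ,
        (stiff a b β lam 1 1 M).mulVec Uh = loadF a b β lam 1 1 f g u M) ∧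
      ∀ Uh : Fin M → ℝ,
        (stiff a b β lam 1 1 M).mulVec Uh = loadF a b β lam 1 1 f g u M →
          dnorm2 a b M (fun i => u (gX a b M (i.val + 1)) - Uh i)
              ≤ C₁ * |Real.log (gH a b M)| * gH a b M ^ 2 ∧
            ∀ i : Fin M,
              |u (gX a b M (i.val + 1)) - Uh i| ≤ C₂ * |Real.log (gH a b M)| * gH a b M ^ 2 := by
  subst hβ
  obtain ⟨C, hC, H⟩ := exists_truncation_bound hab hlam hu hg hug hgint hf
  have hc : 0 < kern lam (b - a + 1) := by
    have : 0 < b - a + 1 := by linarith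
    unfold kern; positivity
  set D := (kern lam (b - a + 1))⁻¹ * C with hD
  have hD0 : 0 < D := by positivity
  have hba : 0 < b - a := sub_pos.2 hab
  refine ⟨Real.sqrt (b - a) * D, by positivity, D, hD0, fun M hM hM1 =>
    ⟨stiff_existsUnique hab hlam hM _, fun Uh hUh => ?_⟩⟩
  have hsup : ∀ i : Fin M,
      |u (gX a b M (i.val + 1)) - Uh i| ≤ D * |Real.log (gH a b M)| * gH a b M ^ 2 := by
    intro i
    have := stiff_stability hab hlam hM (fun i => u (gX a b M (i.val + 1)) - Uh i)
      (ρ := C * |Real.log (gH a b M)| * gH a b M ^ 2) (fun k => by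
        have e : (stiff a b 1 lam 1 1 M).mulVec (fun i => u (gX a b M (i.val + 1)) - Uh i) =
            (stiff a b 1 lam 1 1 M).mulVec (fun i => u (gX a b M (i.val + 1))) -
              (stiff a b 1 lam 1 1 M).mulVec Uh := Matrix.mulVec_sub _ _ _
        rw [e, hUh, Pi.sub_apply]
        exact H M hM hM1 k) i
    rw [hD]
    linarith
  refine ⟨?_, hsup⟩
  rw [mul_assoc (Real.sqrt _ * D), mul_assoc (Real.sqrt _), ← mul_assoc D]
  exact dnorm2_le hab (by positivity) hsup

end
end

section
/- Let β∈(0,2), σ∈{0,1} with σ+1−β>0, let h>0, and let g:[0,h]→ℝ be twice continuously differentiable with g(0)=0. Then |∫₀^h g(y) y^{σ−1−β} dy − (h^{σ−β}/(σ−β+1))·g(h)| ≤ ‖g″‖_{L^∞([0,h])} · h^{σ−β+2} / (2(σ−β+1)(σ−β+2)). -/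
open MeasureTheory

/-- One-sided error bound for linear interpolation on `[0, h]` of a `C²` function vanishing
at `0`. -/
theorem sub_linear_interpolant_le {h M : ℝ} (hh : 0 < h) {g : ℝ → ℝ}
    (hg : ContDiffOn ℝ 2 g (Set.Icc 0 h)) (hg0 : g 0 = 0)
    (hM : ∀ y ∈ Set.Icc 0 h, -M ≤ iteratedDerivWithin 2 g (Set.Icc 0 h) y)
    {y : ℝ} (hy : y ∈ Set.Icc 0 h) :
    g y - y / h * g h ≤ M / 2 * (h * y - y ^ 2) := by
  have hu : UniqueDiffOn ℝ (Set.Icc 0 h) := uniqueDiffOn_Icc hh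
  have hconv : ConvexOn ℝ (Set.Icc 0 h) (fun x => g x + M / 2 * x ^ 2) := by
    refine convexOn_of_hasDerivWithinAt2_nonneg (convex_Icc 0 h)
      (f' := fun x => derivWithin g (Set.Icc 0 h) x + M * x)
      (f'' := fun x => iteratedDerivWithin 2 g (Set.Icc 0 h) x + M) ?_ ?_ ?_ ?_
    · exact hg.continuousOn.add (by fun_prop)
    · intro x hx
      have h1 : HasDerivWithinAt g (derivWithin g (Set.Icc 0 h) x) (interior (Set.Icc 0 h)) x :=
        ((hg.differentiableOn (by norm_num) x (interior_subset hx)).hasDerivWithinAt).mono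
          interior_subset
      refine h1.add (HasDerivAt.hasDerivWithinAt ?_)
      have h2 := (hasDerivAt_pow 2 x).const_mul (M / 2)
      rwa [show M / 2 * (((2 : ℕ) : ℝ) * x ^ (2 - 1)) = M * x by norm_num; ring] at h2
    · intro x hx
      have h1 : ContDiffOn ℝ 1 (derivWithin g (Set.Icc 0 h)) (Set.Icc 0 h) :=
        hg.derivWithin hu (by norm_num)
      have h2 := ((h1.differentiableOn (by norm_num) x (interior_subset hx)).hasDerivWithinAt).mono
          (interior_subset (s := Set.Icc 0 h))
      rw [iteratedDerivWithin_succ, iteratedDerivWithin_one]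
      refine h2.add (HasDerivAt.hasDerivWithinAt ?_)
      simpa using (hasDerivAt_id x).const_mul M
    · intro x hx
      linarith [hM x (interior_subset hx)]
  have key := hconv.2 (Set.left_mem_Icc.2 hh.le) (Set.right_mem_Icc.2 hh.le)
    (sub_nonneg.2 ((div_le_one hh).2 hy.2))
    (div_nonneg hy.1 hh.le) (by ring)
  have e1 : y / h * h = y := div_mul_cancel₀ y hh.ne'
  simp only [smul_eq_mul, mul_zero, zero_add, e1, hg0] at key
  have e2 : y / h * (g h + M / 2 * h ^ 2) = y / h * g h + M / 2 * (h * y) := by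
    field_simp
  rw [e2] at key
  linarith

/-- Two-sided error bound for linear interpolation on `[0, h]` of a `C²` function vanishing
at `0`. -/
theorem abs_sub_linear_interpolant_le {h M : ℝ} (hh : 0 < h) {g : ℝ → ℝ}
    (hg : ContDiffOn ℝ 2 g (Set.Icc 0 h)) (hg0 : g 0 = 0)
    (hM : ∀ y ∈ Set.Icc 0 h, |iteratedDerivWithin 2 g (Set.Icc 0 h) y| ≤ M)
    {y : ℝ} (hy : y ∈ Set.Icc 0 h) :
    |g y - y / h * g h| ≤ M / 2 * (h * y - y ^ 2) := by
  have h1 := sub_linear_interpolant_le hh hg hg0 (fun y hy => (abs_le.1 (hM y hy)).1) hy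
  have h2 := sub_linear_interpolant_le (M := M) hh hg.neg (by simp [hg0])
    (fun y hy => by
      have := (abs_le.1 (hM y hy)).2
      rw [iteratedDerivWithin_fun_neg]
      linarith) hy
  rw [abs_le]
  constructor <;> linarith

/-- Error bound for integrating the linear interpolant against the weight `y ^ (s - 1)`. -/
theorem abs_integral_mul_rpow_sub_le {h M s : ℝ} (hh : 0 < h) (hs : 0 < s + 1) {g : ℝ → ℝ}
    (hg : ContinuousOn g (Set.Icc 0 h))
    (hM : ∀ y ∈ Set.Icc 0 h, |g y - y / h * g h| ≤ M / 2 * (h * y - y ^ 2)) :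
    |(∫ y in (0 : ℝ)..h, g y * y ^ (s - 1)) - h ^ s / (s + 1) * g h|
      ≤ M * h ^ (s + 2) / (2 * (s + 1) * (s + 2)) := by
  have hi0 : IntervalIntegrable (fun y : ℝ => y ^ s) volume 0 h :=
    intervalIntegral.intervalIntegrable_rpow' (by linarith)
  have hi1 : IntervalIntegrable (fun y : ℝ => y ^ (s + 1)) volume 0 h :=
    intervalIntegral.intervalIntegrable_rpow' (by linarith)
  have hJ0 : ∫ y in (0 : ℝ)..h, y ^ s = h ^ (s + 1) / (s + 1) := by
    rw [integral_rpow (Or.inl (by linarith)), Real.zero_rpow hs.ne', sub_zero]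
  have hJ1 : ∫ y in (0 : ℝ)..h, y ^ (s + 1) = h ^ (s + 2) / (s + 2) := by
    rw [integral_rpow (Or.inl (by linarith)), Real.zero_rpow (by linarith), sub_zero]
    ring_nf
  have hb : IntervalIntegrable (fun y : ℝ => M / 2 * (h * y ^ s - y ^ (s + 1))) volume 0 h :=
    ((hi0.const_mul h).sub hi1).const_mul (M / 2)
  have hle : ∀ y ∈ Set.Ioc 0 h,
      ‖g y * y ^ (s - 1) - g h / h * y ^ s‖ ≤ M / 2 * (h * y ^ s - y ^ (s + 1)) := by
    intro y hy
    have e0 : y ^ s = y * y ^ (s - 1) := by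
      rw [Real.rpow_sub_one hy.1.ne']
      field_simp [hy.1.ne']
    have e1 : y ^ (s + 1) = y ^ 2 * y ^ (s - 1) := by
      rw [Real.rpow_add_one hy.1.ne', e0]
      ring
    have hp : 0 ≤ y ^ (s - 1) := Real.rpow_nonneg hy.1.le _
    rw [e1, e0, Real.norm_eq_abs]
    calc |g y * y ^ (s - 1) - g h / h * (y * y ^ (s - 1))|
        = |g y - y / h * g h| * y ^ (s - 1) := by
          rw [← abs_of_nonneg hp, ← abs_mul, abs_of_nonneg hp]
          ring_nf
      _ ≤ M / 2 * (h * y - y ^ 2) * y ^ (s - 1) :=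
          mul_le_mul_of_nonneg_right (hM y ⟨hy.1.le, hy.2⟩) hp
      _ = _ := by ring
  have hc : ContinuousOn (fun y : ℝ => g y * y ^ (s - 1) - g h / h * y ^ s) (Set.Ioc 0 h) := by
    have hr : ∀ p : ℝ, ContinuousOn (fun y : ℝ => y ^ p) (Set.Ioc 0 h) := fun p =>
      continuousOn_id.rpow_const fun y hy => Or.inl hy.1.ne'
    exact ((hg.mono Set.Ioc_subset_Icc_self).mul (hr _)).sub (continuousOn_const.mul (hr _))
  have hE : IntervalIntegrable (fun y : ℝ => g y * y ^ (s - 1) - g h / h * y ^ s) volume 0 h := by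
    rw [intervalIntegrable_iff_integrableOn_Ioc_of_le hh.le] at hb ⊢
    exact Integrable.mono' hb (hc.aestronglyMeasurable measurableSet_Ioc)
      ((ae_restrict_iff' measurableSet_Ioc).2 (Filter.Eventually.of_forall hle))
  have hsplit : (∫ y in (0 : ℝ)..h, g y * y ^ (s - 1)) - h ^ s / (s + 1) * g h
      = ∫ y in (0 : ℝ)..h, (g y * y ^ (s - 1) - g h / h * y ^ s) := by
    have h1 := intervalIntegral.integral_add hE (hi0.const_mul (g h / h))
    simp only [sub_add_cancel] at h1
    have e : h ^ s / (s + 1) * g h = g h / h * (h ^ s * h / (s + 1)) := by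
      field_simp
    rw [h1, intervalIntegral.integral_const_mul, hJ0, Real.rpow_add_one hh.ne', e,
      add_sub_cancel_right]
  rw [hsplit, ← Real.norm_eq_abs]
  refine (intervalIntegral.norm_integral_le_of_norm_le hh.le
    (Filter.Eventually.of_forall hle) hb).trans_eq ?_
  have hs2 : s + 2 ≠ 0 := by linarith
  rw [intervalIntegral.integral_const_mul,
    intervalIntegral.integral_sub (hi0.const_mul h) hi1, intervalIntegral.integral_const_mul,
    hJ0, hJ1, show s + 2 = s + 1 + 1 by ring, Real.rpow_add_one hh.ne' (s + 1)]
  rw [show s + 2 = s + 1 + 1 by ring] at hs2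
  field_simp
  ring

/-- weighted linear-interpolation error estimate on the singular cell `[0,h]`:
for `β ∈ (0,2)`, `σ ∈ {0,1}` with `σ+1−β > 0`, `h > 0` and `g ∈ C²([0,h])` with `g(0)=0`,
`|∫₀^h g(y) y^{σ−1−β} dy − (h^{σ−β}/(σ−β+1))·g(h)|
  ≤ ‖g″‖_{L^∞([0,h])} · h^{σ−β+2} / (2(σ−β+1)(σ−β+2))`. -/
theorem singular_cell_interpolation_error (β h : ℝ) (σ : ℕ) (hβ : β ∈ Set.Ioo (0 : ℝ) 2)
    (hσ : σ = 0 ∨ σ = 1) (hσβ : 0 < (σ : ℝ) + 1 - β) (hh : 0 < h)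
    (g : ℝ → ℝ) (hg : ContDiffOn ℝ 2 g (Set.Icc 0 h)) (hg0 : g 0 = 0) :
    |(∫ y in (0 : ℝ)..h, g y * y ^ ((σ : ℝ) - 1 - β))
        - h ^ ((σ : ℝ) - β) / ((σ : ℝ) - β + 1) * g h|
      ≤ (⨆ y : Set.Icc (0 : ℝ) h, |iteratedDerivWithin 2 g (Set.Icc 0 h) y|)
          * h ^ ((σ : ℝ) - β + 2) / (2 * ((σ : ℝ) - β + 1) * ((σ : ℝ) - β + 2)) := by
  have hbdd : BddAbove (Set.range fun y : Set.Icc (0 : ℝ) h =>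
      |iteratedDerivWithin 2 g (Set.Icc 0 h) y|) := by
    have hcont : ContinuousOn (iteratedDerivWithin 2 g (Set.Icc 0 h)) (Set.Icc 0 h) :=
      hg.continuousOn_iteratedDerivWithin (by norm_num) (uniqueDiffOn_Icc hh)
    have hb := isCompact_Icc.bddAbove_image hcont.abs
    rwa [Set.image_eq_range] at hb
  have hmain := abs_integral_mul_rpow_sub_le (s := (σ : ℝ) - β) hh (by linarith) hg.continuousOn
    fun y hy => abs_sub_linear_interpolant_le hh hg hg0 (fun z hz => le_ciSup hbdd ⟨z, hz⟩) hy
  rwa [show (σ : ℝ) - β - 1 = (σ : ℝ) - 1 - β by ring] at hmain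
end

section
/- Let H be a real M×M matrix (M≥1) such that h_{i,i}>0 for all i, h_{i,j}≤0 for all i≠j, and Σ_{j=1}^M h_{i,j} ≥ b_i for every i, where b_i>0. If U,F∈ℝ^M satisfy HU=F, then max_{1≤i≤M}|U_i| ≤ max_{1≤i≤M}(|F_i|/b_i). -/
/-- At an index where `|U|` is maximal, a row with nonpositive off-diagonal entries satisfies
`(∑ j, H i j) * |U i| ≤ |(H U) i|`. -/
theorem rowSum_mul_abs_le_abs_mulVec {n : Type*} [Fintype n] (H : Matrix n n ℝ) (U : n → ℝ) (i : n)
    (hoff : ∀ j, i ≠ j → H i j ≤ 0) (hmax : ∀ j, |U j| ≤ |U i|) :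
    (∑ j, H i j) * |U i| ≤ |H.mulVec U i| := by
  rw [Finset.sum_mul]
  simp only [Matrix.mulVec, dotProduct]
  rcases abs_choice (U i) with h | h
  · refine le_trans (Finset.sum_le_sum fun j _ => ?_) (le_abs_self _)
    by_cases hij : i = j
    · subst hij
      rw [h]
    · exact mul_le_mul_of_nonpos_left ((le_abs_self _).trans (hmax j)) (hoff j hij)
  · refine le_trans ?_ (neg_le_abs _)
    rw [← Finset.sum_neg_distrib]
    refine Finset.sum_le_sum fun j _ => ?_
    rw [← mul_neg]
    by_cases hij : i = j
    · subst hij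
      rw [h]
    · exact mul_le_mul_of_nonpos_left ((neg_le_abs _).trans (hmax j)) (hoff j hij)


/-- discrete maximum principle: if `H` is a real `M×M` matrix with positive
diagonal, nonpositive off-diagonal entries and row sums `≥ bᵢ > 0`, and `HU = F`,
then `max_i |U_i| ≤ max_i (|F_i|/b_i)`. -/
theorem discrete_maximum_principle (M : ℕ) (hM : 1 ≤ M) (H : Matrix (Fin M) (Fin M) ℝ)
    (bvec : Fin M → ℝ)
    (hb : ∀ i, 0 < bvec i)
    (hdiag : ∀ i, 0 < H i i)
    (hoff : ∀ i j, i ≠ j → H i j ≤ 0)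
    (hrow : ∀ i, bvec i ≤ ∑ j, H i j)
    (U F : Fin M → ℝ) (hUF : H.mulVec U = F) :
    ∀ i, |U i| ≤ Finset.univ.sup' ⟨⟨0, by omega⟩, Finset.mem_univ _⟩
      (fun j : Fin M => |F j| / bvec j) := by
  intro i
  have : Nonempty (Fin M) := ⟨i⟩
  obtain ⟨k, hk⟩ := Finite.exists_max fun j => |U j|
  have hrowk := rowSum_mul_abs_le_abs_mulVec H U k (hoff k) hk
  rw [hUF] at hrowk
  calc |U i| ≤ |U k| := hk i
    _ ≤ |F k| / bvec k := by
      rw [le_div_iff₀' (hb k)]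
      exact (mul_le_mul_of_nonneg_right (hrow k) (abs_nonneg _)).trans hrowk
    _ ≤ _ := Finset.le_sup' (fun j : Fin M => |F j| / bvec j) (Finset.mem_univ k)
end

section
/- Let a<b be reals, β∈(0,1), λ≥0, δ>0, and a<x<b. Then ∫_{−∞}^a e^{λ(y−x)}(x−y)^{−1−β} dy + ∫_b^{∞} e^{λ(x−y)}(y−x)^{−1−β} dy ≥ (2/β) e^{−λ(b−a+δ)} ((b−a)^{−β} − (b−a+δ)^{−β}); in particular, the left-hand side is bounded below by a positive constant depending only on a, b, β, λ (uniformly in x∈(a,b)). -/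
open MeasureTheory

/-- Truncating the tempered power tail to `(L, M]` and bounding the exponential from below. -/
theorem tempered_power_tail_lower_bound {β lam c L M : ℝ} (hβ : 0 < β) (hlam : 0 ≤ lam)
    (hc : 0 < c) (hcL : c ≤ L) (hLM : L ≤ M) :
    1 / β * Real.exp (-lam * M) * (L ^ (-β) - M ^ (-β))
      ≤ ∫ t in Set.Ioi c, Real.exp (-lam * t) * t ^ (-1 - β) := by
  have hL : 0 < L := hc.trans_le hcL
  have hpow : IntegrableOn (fun t : ℝ => t ^ (-1 - β)) (Set.Ioi c) :=
    integrableOn_Ioi_rpow_of_lt (by linarith) hc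
  have hint : IntegrableOn (fun t : ℝ => Real.exp (-lam * t) * t ^ (-1 - β)) (Set.Ioi c) := by
    refine hpow.bdd_mul (c := 1) (by fun_prop) ?_
    filter_upwards [ae_restrict_mem measurableSet_Ioi] with t ht
    have ht' : 0 < t := hc.trans ht
    rw [Real.norm_eq_abs, Real.abs_exp, Real.exp_le_one_iff]
    nlinarith
  have hsub : Set.Ioc L M ⊆ Set.Ioi c := fun t ht => hcL.trans_lt ht.1
  have hval : ∫ t in Set.Ioc L M, t ^ (-1 - β) = 1 / β * (L ^ (-β) - M ^ (-β)) := by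
    rw [← intervalIntegral.integral_of_le hLM, integral_rpow]
    · rw [show -1 - β + 1 = -β by ring]
      field_simp
      ring
    · refine Or.inr ⟨by linarith, ?_⟩
      rw [Set.uIcc_of_le hLM]
      exact fun h => absurd h.1 (not_le.2 hL)
  calc 1 / β * Real.exp (-lam * M) * (L ^ (-β) - M ^ (-β))
      = ∫ t in Set.Ioc L M, Real.exp (-lam * M) * t ^ (-1 - β) := by
        rw [integral_const_mul, hval]
        ring
    _ ≤ ∫ t in Set.Ioc L M, Real.exp (-lam * t) * t ^ (-1 - β) := by
        refine setIntegral_mono_on ((hpow.mono_set hsub).const_mul _) (hint.mono_set hsub)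
          measurableSet_Ioc fun t ht => ?_
        refine mul_le_mul_of_nonneg_right (Real.exp_le_exp.2 ?_)
          (Real.rpow_nonneg (hL.trans ht.1).le _)
        nlinarith [ht.2]
    _ ≤ ∫ t in Set.Ioi c, Real.exp (-lam * t) * t ^ (-1 - β) := by
        refine setIntegral_mono_set hint ?_ hsub.eventuallyLE
        filter_upwards [ae_restrict_mem measurableSet_Ioi] with t ht
        exact mul_nonneg (Real.exp_pos _).le (Real.rpow_nonneg (hc.trans ht).le _)

/-- uniform positive lower bound for the diagonal contribution
`B₁(i)+B₂(i)` of the stiffness matrix: for `a < b`, `β ∈ (0,1)`, `λ ≥ 0`, `δ > 0`, `a < x < b`,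
`∫_{−∞}^a e^{λ(y−x)}(x−y)^{−1−β} dy + ∫_b^∞ e^{λ(x−y)}(y−x)^{−1−β} dy
  ≥ (2/β) e^{−λ(b−a+δ)} ((b−a)^{−β} − (b−a+δ)^{−β}) > 0`. -/
theorem boundary_coefficient_lower_bound (a b β lam δ x : ℝ) (hab : a < b)
    (hβ : β ∈ Set.Ioo (0 : ℝ) 1) (hlam : 0 ≤ lam) (hδ : 0 < δ) (hx : x ∈ Set.Ioo a b) :
    0 < 2 / β * Real.exp (-lam * (b - a + δ)) * ((b - a) ^ (-β) - (b - a + δ) ^ (-β)) ∧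
    2 / β * Real.exp (-lam * (b - a + δ)) * ((b - a) ^ (-β) - (b - a + δ) ^ (-β))
      ≤ (∫ y in Set.Iio a, Real.exp (lam * (y - x)) * (x - y) ^ (-1 - β))
        + ∫ y in Set.Ioi b, Real.exp (lam * (x - y)) * (y - x) ^ (-1 - β) := by
  obtain ⟨hβ, -⟩ := hβ
  obtain ⟨hax, hxb⟩ := hx
  have hL : 0 < b - a := sub_pos.2 hab
  refine ⟨?_, ?_⟩
  · have hlt : (b - a + δ) ^ (-β) < (b - a) ^ (-β) :=
      Real.rpow_lt_rpow_of_neg hL (by linarith) (by linarith)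
    have := sub_pos.2 hlt
    positivity
  have hleft : ∫ y in Set.Iio a, Real.exp (lam * (y - x)) * (x - y) ^ (-1 - β)
      = ∫ t in Set.Ioi (x - a), Real.exp (-lam * t) * t ^ (-1 - β) := by
    rw [← (Measure.measurePreserving_sub_left volume x).setIntegral_preimage_emb
      (MeasurableEquiv.subLeft x).measurableEmbedding, Set.preimage_const_sub_Iio]
    simp only [sub_sub_cancel, sub_sub_cancel_left, mul_neg, neg_mul]
  have hright : ∫ y in Set.Ioi b, Real.exp (lam * (x - y)) * (y - x) ^ (-1 - β)
      = ∫ t in Set.Ioi (b - x), Real.exp (-lam * t) * t ^ (-1 - β) := by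
    rw [← (measurePreserving_add_right volume x).setIntegral_preimage_emb
      (MeasurableEquiv.addRight x).measurableEmbedding, Set.preimage_add_const_Ioi]
    simp only [add_sub_cancel_right, sub_add_cancel_right, mul_neg, neg_mul]
  rw [hleft, hright]
  have h₁ := tempered_power_tail_lower_bound (c := x - a) (L := b - a) (M := b - a + δ)
    hβ hlam (by linarith) (by linarith) (by linarith)
  have h₂ := tempered_power_tail_lower_bound (c := b - x) (L := b - a) (M := b - a + δ)
    hβ hlam (by linarith) (by linarith) (by linarith)
  calc _ = 1 / β * Real.exp (-lam * (b - a + δ)) * ((b - a) ^ (-β) - (b - a + δ) ^ (-β))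
        + 1 / β * Real.exp (-lam * (b - a + δ)) * ((b - a) ^ (-β) - (b - a + δ) ^ (-β)) := by ring
    _ ≤ _ := add_le_add h₁ h₂
end
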